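/- arXiv:2506.02332 — 2 statements merged into one kernel-verified Lean document; each statement's English description precedes it below -/
import Mathlib

section
/- For every base b ≥ 2 and every pair s, s′ ∈ [0,1], there exist an infinite set A ⊆ ℕ and a real number c > 0 (giving the linear polynomial p(x) = cx) such that dim_FS(CE_b(A)) = s and dim_FS(CE_b(p(A))) = s′, where CE_b(p(A)) is the concatenation of the base-b expansions of the integer parts ⌊c·n⌋ for n ∈ A in increasing order of n. -/
/-- Number of sliding-block occurrences of `w` in `s`:
`N(w,s) = |{i : s[i…i+|w|−1] = w}|`. -/
def slideN {α : Type*} [DecidableEq α] (w s : List α) : ℕ :=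
  ((Finset.range (s.length + 1 - w.length)).filter
    (fun i => ((s.drop i).take w.length) = w)).card

/-- Sliding count probability of `w` in `s`: `P(w,s) = N(w,s)/(|s|−|w|+1)`. -/
noncomputable def slideP {α : Type*} [DecidableEq α] (w s : List α) : ℝ :=
  (slideN w s : ℝ) / ((s.length : ℝ) - (w.length : ℝ) + 1)

/-- `l`-th sliding block entropy of a string, with logarithms base `|α|`.
The convention `0 · log(1/0) = 0` holds automatically since `Real.logb b 0⁻¹ = 0`. -/
noncomputable def slideH {α : Type*} [Fintype α] [DecidableEq α] (l : ℕ) (x : List α) : ℝ :=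
  (1 / (l : ℝ)) * ∑ w : Fin l → α,
    slideP (List.ofFn w) x * Real.logb (Fintype.card α) (slideP (List.ofFn w) x)⁻¹

/-- The prefix `S[0…n]` of a sequence, i.e. its first `n+1` symbols. -/
def pre {α : Type*} (S : ℕ → α) (n : ℕ) : List α := List.ofFn (fun i : Fin (n + 1) => S i)

/-- Finite-state dimension via sliding block entropies:
`dim_FS(S) = inf_{l ≥ 1} liminf_{n→∞} H_l(S[0…n])`. -/
noncomputable def dimFS {α : Type*} [Fintype α] [DecidableEq α] (S : ℕ → α) : ℝ :=
  ⨅ l : ℕ, Filter.liminf (fun n => slideH (l + 1) (pre S n)) Filter.atTop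

/-- Finite-state strong dimension:
`Dim_FS(S) = inf_{l ≥ 1} limsup_{n→∞} H_l(S[0…n])`. -/
noncomputable def DimFS {α : Type*} [Fintype α] [DecidableEq α] (S : ℕ → α) : ℝ :=
  ⨅ l : ℕ, Filter.limsup (fun n => slideH (l + 1) (pre S n)) Filter.atTop
/-- Cumulative lengths of a sequence of lists. -/
def cumLen {α : Type*} (L : ℕ → List α) : ℕ → ℕ
  | 0 => 0
  | m + 1 => cumLen L m + (L m).length

open scoped Classical in
/-- The infinite sequence obtained by concatenating the lists `L 0, L 1, L 2, …`
(a default symbol is used in the degenerate case where the total length is finite). -/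
noncomputable def concatSeq {α : Type*} (dflt : α) (L : ℕ → List α) (k : ℕ) : α :=
  if h : ∃ m, k < cumLen L (m + 1) then
    (L (Nat.find h)).getD (k - cumLen L (Nat.find h)) dflt
  else dflt
/-- Big-endian base-`b` digit string of `n`, as symbols in `Σ_b = Fin b`. -/
def digitsFin (b : ℕ) (hb : 0 < b) (n : ℕ) : List (Fin b) :=
  (Nat.digits b n).reverse.map (fun d => ⟨d % b, Nat.mod_lt d hb⟩)

/-- The base-`b` Copeland–Erdős sequence `CE_b(A)` of an infinite set `A ⊆ ℕ`:
the concatenation of the base-`b` expansions of the elements of `A` in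
increasing order (`Nat.nth (· ∈ A)` enumerates `A` in increasing order). -/
noncomputable def CEseq (b : ℕ) (hb : 0 < b) (A : Set ℕ) : ℕ → Fin b :=
  concatSeq ⟨0, hb⟩ (fun i => digitsFin b hb (Nat.nth (· ∈ A) i))

/-- The base-`b` Copeland–Erdős sequence `CE_b(f(A))` for `f : ℕ → ℝ`:
the concatenation of the base-`b` expansions of the integer parts `⌊f(n)⌋`
for `n ∈ A` in increasing order of `n`. -/
noncomputable def CEseqF (b : ℕ) (hb : 0 < b) (A : Set ℕ) (f : ℕ → ℝ) : ℕ → Fin b :=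
  concatSeq ⟨0, hb⟩ (fun i => digitsFin b hb ⌊f (Nat.nth (· ∈ A) i)⌋₊)

/-- The mass of the word `w` under the mixture, with weights `t` and `1 - t`, of the uniform
distribution and of the point mass at the constant word with symbol `z`. -/
noncomputable def mixWeight {α : Type*} [Fintype α] [DecidableEq α] (z : α) (t : ℝ)
    (w : List α) : ℝ :=
  t * ((Fintype.card α : ℝ)⁻¹) ^ w.length +
    (1 - t) * (if w = List.replicate w.length z then 1 else 0)

section Entropy

variable {α : Type*} [Fintype α] [DecidableEq α]

lemma mixWeight_ofFn (z : α) (t : ℝ) {l : ℕ} (w : Fin l → α) :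
    mixWeight z t (List.ofFn w) =
      t * ((Fintype.card α : ℝ)⁻¹) ^ l + (1 - t) * (if w = (fun _ => z) then 1 else 0) := by
  have : (List.ofFn w = List.replicate l z) ↔ w = (fun _ => z) := by
    rw [← List.ofFn_const]
    exact List.ofFn_injective.eq_iff
  simp [mixWeight, this]

lemma slideH_eq_negMulLog (l : ℕ) (x : List α) :
    slideH l x = (∑ w : Fin l → α, Real.negMulLog (slideP (List.ofFn w) x)) /
      (l * Real.log (Fintype.card α)) := by
  unfold slideH
  rw [Finset.sum_div, Finset.mul_sum]
  refine Finset.sum_congr rfl fun w _ => ?_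
  simp only [Real.logb, Real.log_inv, Real.negMulLog, div_eq_mul_inv, mul_inv]
  ring

omit [DecidableEq α] in
lemma negMulLog_uniform (l : ℕ) :
    Real.negMulLog (((Fintype.card α : ℝ)⁻¹) ^ l) =
      ((Fintype.card α : ℝ)⁻¹) ^ l * (l * Real.log (Fintype.card α)) := by
  simp [Real.negMulLog]

lemma le_sum_negMulLog_mixWeight [Nonempty α] (z : α) {t : ℝ} (ht : t ∈ Set.Icc (0 : ℝ) 1)
    (l : ℕ) :
    t * (l * Real.log (Fintype.card α)) ≤
      ∑ w : Fin l → α, Real.negMulLog (mixWeight z t (List.ofFn w)) := by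
  have hB : (Fintype.card α : ℝ) ≠ 0 := by
    exact_mod_cast Fintype.card_ne_zero
  calc t * (l * Real.log (Fintype.card α))
      = ∑ _w : Fin l → α, t * Real.negMulLog (((Fintype.card α : ℝ)⁻¹) ^ l) := by
        rw [negMulLog_uniform, Finset.sum_const, Finset.card_univ, Fintype.card_fun,
          Fintype.card_fin]
        simp only [nsmul_eq_mul, inv_pow]
        push_cast
        field_simp
    _ ≤ _ := by
        refine Finset.sum_le_sum fun w _ => ?_
        rw [mixWeight_ofFn]
        have := Real.concaveOn_negMulLog.2
          (x := ((Fintype.card α : ℝ)⁻¹) ^ l) (y := if w = (fun _ => z) then 1 else 0)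
          (by simp only [Set.mem_Ici]; positivity)
          (by simp only [Set.mem_Ici]; split_ifs <;> norm_num)
          ht.1 (sub_nonneg.2 ht.2) (by ring)
        simp only [smul_eq_mul] at this
        refine le_trans ?_ this
        split_ifs <;> simp

lemma negMulLog_add_le {x y : ℝ} (hx : 0 ≤ x) (hy : 0 ≤ y) :
    Real.negMulLog (x + y) ≤ Real.negMulLog x + Real.negMulLog y := by
  have key : ∀ {u v : ℝ}, 0 ≤ u → 0 ≤ v → u * Real.log u ≤ u * Real.log (u + v) := by
    intro u v hu hv
    rcases hu.eq_or_lt with h | h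
    · simp [← h]
    · exact mul_le_mul_of_nonneg_left (Real.log_le_log h (by linarith)) hu
  have h1 := key hx hy
  have h2 := key hy hx
  rw [add_comm y x] at h2
  simp only [Real.negMulLog]
  linarith

lemma sum_negMulLog_mixWeight_le [Nonempty α] (z : α) {t : ℝ} (ht : t ∈ Set.Icc (0 : ℝ) 1)
    (l : ℕ) :
    ∑ w : Fin l → α, Real.negMulLog (mixWeight z t (List.ofFn w)) ≤
      t * (l * Real.log (Fintype.card α)) + 1 := by
  have hB : (Fintype.card α : ℝ) ≠ 0 := by
    exact_mod_cast Fintype.card_ne_zero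
  have hself : ∀ {x : ℝ}, 0 ≤ x → Real.negMulLog x ≤ 1 - x := by
    intro x hx
    rcases hx.eq_or_lt with h | h
    · simp [← h]
    · have h1 := Real.one_sub_inv_le_log_of_pos h
      have h2 := mul_le_mul_of_nonneg_left h1 hx
      rw [mul_sub, mul_inv_cancel₀ h.ne'] at h2
      simp only [Real.negMulLog]
      linarith
  have ht' : 0 ≤ 1 - t := sub_nonneg.2 ht.2
  calc ∑ w : Fin l → α, Real.negMulLog (mixWeight z t (List.ofFn w))
      ≤ ∑ w : Fin l → α, ((((Fintype.card α : ℝ)⁻¹) ^ l * Real.negMulLog t +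
          t * Real.negMulLog (((Fintype.card α : ℝ)⁻¹) ^ l)) +
          (if w = (fun _ => z) then Real.negMulLog (1 - t) else 0)) := by
        refine Finset.sum_le_sum fun w _ => ?_
        rw [mixWeight_ofFn]
        refine (negMulLog_add_le (mul_nonneg ht.1 (by positivity))
          (mul_nonneg ht' (by split_ifs <;> norm_num))).trans ?_
        rw [Real.negMulLog_mul]
        split_ifs <;> simp
    _ = Real.negMulLog t + t * (l * Real.log (Fintype.card α)) + Real.negMulLog (1 - t) := by
        rw [Finset.sum_add_distrib, Finset.sum_ite_eq' Finset.univ (fun _ => z)]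
        simp only [Finset.mem_univ, if_true]
        rw [negMulLog_uniform, Finset.sum_const, Finset.card_univ, Fintype.card_fun,
          Fintype.card_fin]
        simp only [nsmul_eq_mul, inv_pow]
        push_cast
        field_simp
    _ ≤ _ := by
        have h1 := hself ht.1
        have h2 := hself ht'
        linarith

lemma mixWeight_mem_Icc [Nonempty α] (z : α) {t : ℝ} (ht : t ∈ Set.Icc (0 : ℝ) 1)
    (w : List α) : mixWeight z t w ∈ Set.Icc (0 : ℝ) 1 := by
  have h1 : ((Fintype.card α : ℝ)⁻¹) ^ w.length ≤ 1 := by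
    refine pow_le_one₀ (by positivity) (inv_le_one_of_one_le₀ ?_)
    exact_mod_cast Fintype.card_pos
  have h0 : 0 ≤ ((Fintype.card α : ℝ)⁻¹) ^ w.length := by positivity
  have hi : (if w = List.replicate w.length z then (1 : ℝ) else 0) ∈ Set.Icc (0 : ℝ) 1 := by
    split_ifs <;> simp
  have ht' : 0 ≤ 1 - t := sub_nonneg.2 ht.2
  constructor
  · exact add_nonneg (mul_nonneg ht.1 h0) (mul_nonneg ht' hi.1)
  · unfold mixWeight
    nlinarith [mul_le_mul_of_nonneg_left h1 ht.1, mul_le_mul_of_nonneg_left hi.2 ht']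

lemma tendsto_negMulLog_sub {u v : ℕ → ℝ} (hv : ∀ n, v n ∈ Set.Icc (0 : ℝ) 1)
    (huv : Filter.Tendsto (fun n => u n - v n) Filter.atTop (nhds 0)) :
    Filter.Tendsto (fun n => Real.negMulLog (u n) - Real.negMulLog (v n)) Filter.atTop
      (nhds 0) := by
  have huc : UniformContinuousOn Real.negMulLog (Set.Icc (-1 : ℝ) 2) :=
    isCompact_Icc.uniformContinuousOn_of_continuous Real.continuous_negMulLog.continuousOn
  rw [Metric.uniformContinuousOn_iff] at huc
  rw [Metric.tendsto_atTop] at huv ⊢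
  intro ε hε
  obtain ⟨δ, hδ, h⟩ := huc ε hε
  obtain ⟨N, hN⟩ := huv (min δ 1) (lt_min hδ one_pos)
  refine ⟨N, fun n hn => ?_⟩
  have h1 := hN n hn
  rw [Real.dist_eq, sub_zero, lt_min_iff] at h1
  have h2 := abs_lt.1 h1.2
  have h3 := hv n
  have := h (u n) ⟨by linarith [h3.1], by linarith [h3.2]⟩ (v n)
    ⟨by linarith [h3.1], by linarith [h3.2]⟩ (by rw [Real.dist_eq]; exact h1.1)
  rw [Real.dist_eq] at this
  rwa [Real.dist_eq, sub_zero]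

/-- If the block frequencies of the prefixes of `S` are asymptotically those of mixtures of the
uniform distribution and of a point mass at a constant word, the finite-state dimension of `S` is
the lower limit of the weight of the uniform distribution. -/
theorem dimFS_eq_of_mixWeight (hα : 2 ≤ Fintype.card α) (z : α) (S : ℕ → α) (t : ℕ → ℝ) (s : ℝ)
    (ht : ∀ n, t n ∈ Set.Icc (0 : ℝ) 1)
    (hP : ∀ w : List α, w ≠ [] → Filter.Tendsto
      (fun n => slideP w (pre S n) - mixWeight z (t n) w) Filter.atTop (nhds 0))
    (hlow : ∀ ε > 0, ∀ᶠ n in Filter.atTop, s - ε ≤ t n)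
    (hup : ∀ ε > 0, ∃ᶠ n in Filter.atTop, t n ≤ s + ε) :
    dimFS S = s := by
  have : Nonempty α := ⟨z⟩
  set c : ℝ := Real.log (Fintype.card α) with hc
  have hcpos : 0 < c := Real.log_pos (by exact_mod_cast hα)
  set F : ℕ → ℕ → ℝ := fun l n =>
    (∑ w : Fin (l + 1) → α, Real.negMulLog (mixWeight z (t n) (List.ofFn w))) /
      ((l + 1 : ℕ) * c) with hF
  have hHF : ∀ l, Filter.Tendsto (fun n => slideH (l + 1) (pre S n) - F l n) Filter.atTop
      (nhds 0) := by
    intro l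
    have : Filter.Tendsto (fun n => (∑ w : Fin (l + 1) → α,
        (Real.negMulLog (slideP (List.ofFn w) (pre S n)) -
          Real.negMulLog (mixWeight z (t n) (List.ofFn w)))) / ((l + 1 : ℕ) * c)) Filter.atTop
        (nhds ((∑ w : Fin (l + 1) → α, (0 : ℝ)) / ((l + 1 : ℕ) * c))) := by
      refine Filter.Tendsto.div_const (tendsto_finsetSum _ fun w _ => ?_) _
      exact tendsto_negMulLog_sub (fun n => mixWeight_mem_Icc z (ht n) _)
        (hP _ (by simp [List.ofFn_succ]))
    simp only [Finset.sum_const_zero, zero_div] at this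
    refine this.congr fun n => ?_
    rw [slideH_eq_negMulLog, Finset.sum_sub_distrib, sub_div]
  have hlpos : ∀ l : ℕ, (0 : ℝ) < (l + 1 : ℕ) * c := fun l => by positivity
  have hFlow : ∀ l n, t n ≤ F l n := by
    intro l n
    rw [hF, le_div_iff₀ (hlpos l)]
    exact le_sum_negMulLog_mixWeight z (ht n) (l + 1)
  have hFup : ∀ l n, F l n ≤ t n + 1 / ((l + 1 : ℕ) * c) := by
    intro l n
    rw [hF, div_le_iff₀ (hlpos l), add_mul, one_div, inv_mul_cancel₀ (hlpos l).ne']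
    exact sum_negMulLog_mixWeight_le z (ht n) (l + 1)
  have hnear : ∀ l, ∀ ε > 0, ∀ᶠ n in Filter.atTop,
      t n - ε ≤ slideH (l + 1) (pre S n) ∧
        slideH (l + 1) (pre S n) ≤ t n + 1 / ((l + 1 : ℕ) * c) + ε := by
    intro l ε hε
    filter_upwards [(Metric.tendsto_nhds.1 (hHF l)) ε hε] with n hn
    rw [Real.dist_eq, sub_zero, abs_lt] at hn
    have h1 := hFlow l n
    have h2 := hFup l n
    constructor <;> linarith
  have hbelow : ∀ l, Filter.IsBoundedUnder (· ≥ ·) Filter.atTop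
      (fun n => slideH (l + 1) (pre S n)) := by
    intro l
    refine ⟨-1, ?_⟩
    rw [Filter.eventually_map]
    filter_upwards [hnear l 1 one_pos] with n hn
    linarith [hn.1, (ht n).1]
  have habove : ∀ l, Filter.IsBoundedUnder (· ≤ ·) Filter.atTop
      (fun n => slideH (l + 1) (pre S n)) := by
    intro l
    refine ⟨1 + 1 / ((l + 1 : ℕ) * c) + 1, ?_⟩
    rw [Filter.eventually_map]
    filter_upwards [hnear l 1 one_pos] with n hn
    linarith [hn.2, (ht n).2]
  have hLlow : ∀ l, s ≤ Filter.liminf (fun n => slideH (l + 1) (pre S n)) Filter.atTop := by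
    intro l
    refine le_of_forall_pos_sub_le fun ε hε => ?_
    refine Filter.le_liminf_of_le (habove l).isCoboundedUnder_ge ?_
    filter_upwards [hnear l (ε / 2) (by linarith), hlow (ε / 2) (by linarith)] with n h1 h2
    linarith [h1.1]
  have hLup : ∀ l, Filter.liminf (fun n => slideH (l + 1) (pre S n)) Filter.atTop ≤
      s + 1 / ((l + 1 : ℕ) * c) := by
    intro l
    refine le_of_forall_pos_le_add fun ε hε => ?_
    refine Filter.liminf_le_of_frequently_le ?_ (hbelow l)
    refine ((hup (ε / 2) (by linarith)).and_eventually (hnear l (ε / 2) (by linarith))).mono ?_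
    rintro n ⟨h1, h2⟩
    linarith [h2.2]
  refine le_antisymm ?_ (le_ciInf hLlow)
  have hlim : Filter.Tendsto (fun l : ℕ => s + 1 / ((l + 1 : ℕ) * c)) Filter.atTop
      (nhds (s + 0)) := by
    refine tendsto_const_nhds.add ?_
    have h := (tendsto_one_div_add_atTop_nhds_zero_nat (𝕜 := ℝ)).div_const c
    rw [zero_div] at h
    refine h.congr fun l => ?_
    push_cast
    rw [div_div]
  rw [add_zero] at hlim
  exact ge_of_tendsto' hlim fun l =>
    (ciInf_le ⟨s, by rintro _ ⟨k, rfl⟩; exact hLlow k⟩ l).trans (hLup l)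

end Entropy

section Occurrences

variable {α : Type*} [DecidableEq α]

lemma slideN_nil {w : List α} (hw : w ≠ []) : slideN w [] = 0 := by
  have : 0 < w.length := List.length_pos_iff.2 hw
  have h : (([] : List α).length + 1 - w.length) = 0 := by simp only [List.length_nil]; omega
  rw [slideN, h]
  simp

lemma slideN_cons {w : List α} (hw : w ≠ []) (a : α) (s : List α) :
    slideN w (a :: s) = slideN w s + if w <+: a :: s then 1 else 0 := by
  have hpos : 0 < w.length := List.length_pos_iff.2 hw
  have hpre : w <+: a :: s ↔ (a :: s).take w.length = w := by
    rw [List.prefix_iff_eq_take, eq_comm]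
  unfold slideN
  rcases le_or_gt w.length (s.length + 1) with h | h
  · have e : (a :: s).length + 1 - w.length = (s.length + 1 - w.length) + 1 := by
      simp only [List.length_cons]; omega
    rw [e, Finset.range_add_one', Finset.filter_insert, Finset.filter_map]
    simp only [hpre, List.drop_zero]
    split_ifs with h1
    · rw [Finset.card_insert_of_notMem (by simp), Finset.card_map]
      rfl
    · rw [Finset.card_map]
      rfl
  · have e1 : (a :: s).length + 1 - w.length = 0 := by
      simp only [List.length_cons]; omega
    have e2 : s.length + 1 - w.length = 0 := by omega
    rw [e1, e2, if_neg]
    · simp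
    · intro h'
      have := h'.length_le
      simp only [List.length_cons] at this
      omega

lemma slideN_le_length {w : List α} (hw : w ≠ []) (s : List α) : slideN w s ≤ s.length := by
  induction s with
  | nil => simp [slideN_nil hw]
  | cons a s ih =>
    rw [slideN_cons hw, List.length_cons]
    split_ifs <;> omega

lemma slideN_add_le_append {w : List α} (hw : w ≠ []) (x y : List α) :
    slideN w x + slideN w y ≤ slideN w (x ++ y) := by
  induction x with
  | nil => simp [slideN_nil hw]
  | cons a x ih =>
    rw [List.cons_append, slideN_cons hw, slideN_cons hw]
    have : w <+: a :: x → w <+: a :: (x ++ y) := fun h => by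
      rw [← List.cons_append]
      exact h.trans (List.prefix_append _ _)
    split_ifs <;> first | omega | tauto

lemma slideN_append_le {w : List α} (hw : w ≠ []) (x y : List α) :
    slideN w (x ++ y) ≤ slideN w x + slideN w y + min x.length w.length := by
  induction x with
  | nil => simp [slideN_nil hw]
  | cons a x ih =>
    rw [List.cons_append, slideN_cons hw, slideN_cons hw, List.length_cons]
    rcases lt_or_ge x.length w.length with h | h
    · rw [min_eq_left h.le] at ih
      rw [min_eq_left (by omega)]
      split_ifs <;> omega
    · have : w <+: a :: (x ++ y) → w <+: a :: x := fun h' => by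
        rw [← List.cons_append] at h'
        exact List.prefix_of_prefix_length_le h' (List.prefix_append _ _)
          (by simp only [List.length_cons]; omega)
      rw [min_eq_right h] at ih
      rw [min_eq_right (by omega)]
      split_ifs <;> first | omega | tauto

lemma slideN_replicate_le {w : List α} (hw : w ≠ []) (z : α) (k : ℕ) :
    slideN w (List.replicate k z) ≤ if w = List.replicate w.length z then k else 0 := by
  split_ifs with h
  · simpa using slideN_le_length hw (List.replicate k z)
  · rw [Nat.le_zero, slideN, Finset.card_eq_zero, Finset.filter_eq_empty_iff]
    intro i _ h'
    refine h ?_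
    rw [List.drop_replicate, List.take_replicate] at h'
    rw [← h', List.length_replicate]

lemma le_slideN_replicate {w : List α} (z : α) (k : ℕ) :
    (if w = List.replicate w.length z then k else 0) ≤
      slideN w (List.replicate k z) + w.length := by
  split_ifs with h
  · rw [slideN, Finset.filter_true_of_mem]
    · simp only [List.length_replicate, Finset.card_range]
      omega
    · intro i hi
      rw [Finset.mem_range, List.length_replicate] at hi
      rw [List.drop_replicate, List.take_replicate, min_eq_left (by omega), ← h]
  · exact Nat.zero_le _

end Occurrences

section Concatenation

variable {α : Type*}

/-- The concatenation of the first `m` lists of a sequence of lists. -/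
def concatInit (L : ℕ → List α) : ℕ → List α
  | 0 => []
  | m + 1 => concatInit L m ++ L m

lemma length_concatInit (L : ℕ → List α) (m : ℕ) :
    (concatInit L m).length = cumLen L m := by
  induction m with
  | zero => rfl
  | succ m ih => simp [concatInit, cumLen, ih]

lemma cumLen_eq_sum (L : ℕ → List α) (m : ℕ) :
    cumLen L m = ∑ i ∈ Finset.range m, (L i).length := by
  induction m with
  | zero => rfl
  | succ m ih => rw [cumLen, ih, Finset.sum_range_succ]

lemma cumLen_mono (L : ℕ → List α) : Monotone (cumLen L) :=
  monotone_nat_of_le_succ fun m => by simp [cumLen]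

lemma concatSeq_eq_getD (d : α) (L : ℕ → List α) {m k : ℕ} (h1 : cumLen L m ≤ k)
    (h2 : k < cumLen L (m + 1)) : concatSeq d L k = (L m).getD (k - cumLen L m) d := by
  classical
  have h : ∃ m, k < cumLen L (m + 1) := ⟨m, h2⟩
  have hf : Nat.find h = m := by
    rw [Nat.find_eq_iff]
    refine ⟨h2, fun n hn => ?_⟩
    exact not_lt.2 ((cumLen_mono L hn).trans h1)
  unfold concatSeq
  rw [dif_pos h]
  rw [hf]

lemma concatInit_getD (d : α) (L : ℕ → List α) (m : ℕ) {k : ℕ} (hk : k < cumLen L m) :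
    (concatInit L m).getD k d = concatSeq d L k := by
  induction m with
  | zero => simp [cumLen] at hk
  | succ m ih =>
    rcases lt_or_ge k (cumLen L m) with h | h
    · rw [concatInit, List.getD_append _ _ _ _ (by rwa [length_concatInit]), ih h]
    · rw [concatInit, List.getD_append_right _ _ _ _ (by rwa [length_concatInit]),
        concatSeq_eq_getD d L h hk, length_concatInit]

lemma pre_concatSeq (d : α) (L : ℕ → List α) {m n : ℕ} (h1 : cumLen L m ≤ n + 1)
    (h2 : n + 1 ≤ cumLen L (m + 1)) :
    pre (concatSeq d L) n = concatInit L m ++ (L m).take (n + 1 - cumLen L m) := by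
  have : concatInit L m ++ (L m).take (n + 1 - cumLen L m) =
      (concatInit L (m + 1)).take (n + 1) := by
    rw [concatInit, List.take_append, length_concatInit,
      List.take_of_length_le (l := concatInit L m) (by rwa [length_concatInit])]
  rw [this]
  refine List.ext_getElem ?_ fun i hi _ => ?_
  · simp [pre, length_concatInit, h2]
  · simp only [pre, List.getElem_ofFn, List.getElem_take]
    rw [pre, List.length_ofFn] at hi
    rw [← concatInit_getD d L (m + 1) (by omega)]
    exact List.getD_eq_getElem _ _ _

variable [DecidableEq α]

lemma slideN_concatInit_le {w : List α} (hw : w ≠ []) (L : ℕ → List α) (m : ℕ) :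
    slideN w (concatInit L m) ≤
      (∑ i ∈ Finset.range m, slideN w (L i)) + m * w.length := by
  induction m with
  | zero => simp [concatInit, slideN_nil hw]
  | succ m ih =>
    rw [concatInit, Finset.sum_range_succ, add_mul, one_mul]
    have := slideN_append_le hw (concatInit L m) (L m)
    have := min_le_right (concatInit L m).length w.length
    omega

lemma sum_slideN_le_concatInit {w : List α} (hw : w ≠ []) (L : ℕ → List α) (m : ℕ) :
    ∑ i ∈ Finset.range m, slideN w (L i) ≤ slideN w (concatInit L m) := by
  induction m with
  | zero => simp
  | succ m ih =>
    rw [concatInit, Finset.sum_range_succ]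
    have := slideN_add_le_append hw (concatInit L m) (L m)
    omega

end Concatenation

section MixtureConcatenation

variable {α : Type*} [Fintype α] [DecidableEq α]

lemma sum_mul_mixWeight (z : α) (a τ : ℕ → ℝ) (w : List α) (m : ℕ)
    (hA : ∑ i ∈ Finset.range m, a i ≠ 0) :
    ∑ i ∈ Finset.range m, a i * mixWeight z (τ i) w =
      (∑ i ∈ Finset.range m, a i) *
        mixWeight z ((∑ i ∈ Finset.range m, a i * τ i) / ∑ i ∈ Finset.range m, a i) w := by
  set A := ∑ i ∈ Finset.range m, a i with hAdef
  set u := ((Fintype.card α : ℝ)⁻¹) ^ w.length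
  set v : ℝ := if w = List.replicate w.length z then 1 else 0
  have h1 : ∀ i, a i * mixWeight z (τ i) w = a i * τ i * (u - v) + a i * v := fun i => by
    simp only [mixWeight]
    ring
  simp only [h1]
  rw [Finset.sum_add_distrib, ← Finset.sum_mul, ← Finset.sum_mul, ← hAdef]
  simp only [mixWeight]
  field_simp
  ring

lemma abs_div_sub_le {A x r r' δ : ℝ} (hA : 0 < A) (hx : x ∈ Set.Icc (0 : ℝ) 1)
    (hr : |r| ≤ δ) (hr' : |r'| ≤ δ) (hδ : δ ≤ A / 2) :
    |(A * x + r) / (A + r') - x| ≤ 4 * (δ / A) := by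
  have h' := abs_le.1 hr'
  have hden : A / 2 ≤ A + r' := by linarith
  have hpos : 0 < A + r' := by linarith
  have e : (A * x + r) / (A + r') - x = (r - r' * x) / (A + r') := by
    field_simp
    ring
  have hδ0 : 0 ≤ δ := (abs_nonneg r).trans hr
  have hnum : |r - r' * x| ≤ 2 * δ := by
    calc |r - r' * x| ≤ |r| + |r' * x| := abs_sub _ _
      _ = |r| + |r'| * x := by rw [abs_mul, abs_of_nonneg hx.1]
      _ ≤ δ + δ * 1 := add_le_add hr (mul_le_mul hr' hx.2 hx.1 hδ0)
      _ = 2 * δ := by ring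
  rw [e, abs_div, abs_of_pos hpos]
  calc |r - r' * x| / (A + r') ≤ 2 * δ / (A / 2) :=
        div_le_div₀ (by linarith) hnum (by linarith) hden
    _ = 4 * (δ / A) := by
        field_simp
        ring

/-- Finite-state dimension of a concatenation of lists, of asymptotic lengths `a i`, which are
asymptotically distributed as mixtures of the uniform distribution and of a point mass. -/
theorem dimFS_concatSeq (hα : 2 ≤ Fintype.card α) (z : α) (L : ℕ → List α) (a τ : ℕ → ℝ) (s : ℝ)
    (hL : ∀ i, L i ≠ [])
    (ha : ∀ i, 0 < a i)
    (hone : (fun _ : ℕ => (1 : ℝ)) =o[Filter.atTop] a)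
    (hsum : a =o[Filter.atTop] fun m => ∑ i ∈ Finset.range m, a i)
    (hτ : ∀ i, τ i ∈ Set.Icc (0 : ℝ) 1)
    (hlen : (fun i => ((L i).length : ℝ) - a i) =o[Filter.atTop] a)
    (hN : ∀ w : List α, w ≠ [] →
      (fun i => (slideN w (L i) : ℝ) - a i * mixWeight z (τ i) w) =o[Filter.atTop] a)
    (hlow : ∀ ε > 0, ∀ᶠ m in Filter.atTop,
      s - ε ≤ (∑ i ∈ Finset.range m, a i * τ i) / ∑ i ∈ Finset.range m, a i)
    (hup : ∀ ε > 0, ∃ᶠ m in Filter.atTop,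
      (∑ i ∈ Finset.range m, a i * τ i) / ∑ i ∈ Finset.range m, a i ≤ s + ε) :
    dimFS (concatSeq z L) = s := by
  classical
  have : Nonempty α := ⟨z⟩
  set A : ℕ → ℝ := fun m => ∑ i ∈ Finset.range m, a i with hAdef
  set t : ℕ → ℝ := fun m => (∑ i ∈ Finset.range m, a i * τ i) / A m with htdef
  have hA0 : ∀ m, 0 ≤ A m := fun m => Finset.sum_nonneg fun i _ => (ha i).le
  have ha' : Filter.Tendsto a Filter.atTop Filter.atTop := by
    have h := (Asymptotics.isLittleO_const_left_of_ne (one_ne_zero (α := ℝ))).1 hone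
    refine h.congr fun i => ?_
    simp [abs_of_pos (ha i)]
  have hAtop : Filter.Tendsto A Filter.atTop Filter.atTop := by
    rw [← Filter.tendsto_add_atTop_iff_nat 1]
    refine Filter.tendsto_atTop_mono (fun m => ?_) ha'
    simp only [hAdef]
    rw [Finset.sum_range_succ]
    linarith [hA0 m]
  have ht : ∀ m, t m ∈ Set.Icc (0 : ℝ) 1 := by
    intro m
    refine ⟨div_nonneg (Finset.sum_nonneg fun i _ => mul_nonneg (ha i).le (hτ i).1) (hA0 m),
      div_le_one_of_le₀ (Finset.sum_le_sum fun i _ => ?_) (hA0 m)⟩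
    exact mul_le_of_le_one_right (ha i).le (hτ i).2
  have hlt : ∀ m, cumLen L m < cumLen L (m + 1) := fun m => by
    have := List.length_pos_iff.2 (hL m)
    simp only [cumLen]
    omega
  have hmono : StrictMono (cumLen L) := strictMono_nat_of_lt_succ hlt
  have hex : ∀ n, ∃ m, n + 1 < cumLen L (m + 1) := fun n =>
    ⟨n + 1, lt_of_lt_of_le (Nat.lt_succ_self _) (hmono.id_le _)⟩
  set idx : ℕ → ℕ := fun n => Nat.find (hex n) with hidx
  have hidx2 : ∀ n, n + 1 < cumLen L (idx n + 1) := fun n => Nat.find_spec (hex n)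
  have hidx1 : ∀ n, cumLen L (idx n) ≤ n + 1 := by
    intro n
    rcases Nat.eq_zero_or_pos (idx n) with h | h
    · rw [h]
      exact Nat.zero_le _
    · have := Nat.find_min (hex n) (m := idx n - 1) (by simp only [hidx] at h ⊢; omega)
      rw [Nat.sub_add_cancel h] at this
      exact not_lt.1 this
  have hidxtop : Filter.Tendsto idx Filter.atTop Filter.atTop := by
    rw [Filter.tendsto_atTop]
    intro M
    filter_upwards [Filter.eventually_ge_atTop (cumLen L M)] with n hn
    by_contra hlt'
    have h1 := hmono.monotone (show idx n + 1 ≤ M by omega)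
    have h2 := hidx2 n
    omega
  refine dimFS_eq_of_mixWeight hα z _ (fun n => t (idx n)) s (fun n => ht _) ?_ ?_ ?_
  · intro w hw
    have hcum : (fun m => (cumLen L m : ℝ) - A m) =o[Filter.atTop] A := by
      refine (hlen.sum_range (fun i => (ha i).le) hAtop).congr_left fun m => ?_
      rw [Finset.sum_sub_distrib, cumLen_eq_sum]
      push_cast
      rfl
    have hcnt : (fun m => ∑ i ∈ Finset.range m,
        ((slideN w (L i) : ℝ) - a i * mixWeight z (τ i) w)) =o[Filter.atTop] A :=
      (hN w hw).sum_range (fun i => (ha i).le) hAtop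
    have hm : (fun m : ℕ => (m : ℝ)) =o[Filter.atTop] A := by
      refine (hone.sum_range (fun i => (ha i).le) hAtop).congr_left fun m => ?_
      simp
    have hLm : (fun m => ((L m).length : ℝ)) =o[Filter.atTop] A := by
      refine ((hlen.trans hsum).add hsum).congr_left fun m => ?_
      ring
    set δ : ℕ → ℝ := fun m => |∑ i ∈ Finset.range m,
        ((slideN w (L i) : ℝ) - a i * mixWeight z (τ i) w)| + |(cumLen L m : ℝ) - A m| +
        w.length * m + (L m).length + (2 * w.length + 2) * 1 with hδdef
    have hδ : δ =o[Filter.atTop] A := by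
      refine ((((hcnt.abs_left).add hcum.abs_left).add (hm.const_mul_left _)).add hLm).add
        (Asymptotics.IsLittleO.const_mul_left (hone.trans hsum) _)
    have hδlim : Filter.Tendsto (fun m => δ m / A m) Filter.atTop (nhds 0) :=
      hδ.tendsto_div_nhds_zero
    have hlim : Filter.Tendsto (fun n => 4 * (δ (idx n) / A (idx n))) Filter.atTop (nhds 0) := by
      simpa using (hδlim.comp hidxtop).const_mul 4
    refine squeeze_zero_norm' ?_ hlim
    have hev : ∀ᶠ m in Filter.atTop, 0 < A m ∧ δ m ≤ A m / 2 := by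
      filter_upwards [hAtop.eventually_gt_atTop 0, hδlim.eventually_le_const
        (show (0 : ℝ) < 1 / 2 by norm_num)] with m h1 h2
      rw [div_le_iff₀ h1] at h2
      exact ⟨h1, by linarith⟩
    filter_upwards [hidxtop.eventually hev] with n hn
    obtain ⟨hApos, hδA⟩ := hn
    set m := idx n with hmdef
    have h1 := hidx1 n
    have h2 := hidx2 n
    rw [← hmdef] at h1 h2
    have hpre := pre_concatSeq z L h1 h2.le
    have hub := slideN_append_le hw (concatInit L m) ((L m).take (n + 1 - cumLen L m))
    have hub2 := slideN_concatInit_le hw L m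
    have hlb := slideN_add_le_append hw (concatInit L m) ((L m).take (n + 1 - cumLen L m))
    have hlb2 := sum_slideN_le_concatInit hw L m
    have hmin := min_le_right (concatInit L m).length w.length
    have htake : slideN w ((L m).take (n + 1 - cumLen L m)) ≤ (L m).length :=
      (slideN_le_length hw _).trans (List.length_take_le' _ _)
    rw [← hpre] at hub hlb
    have hlower : ∑ i ∈ Finset.range m, slideN w (L i) ≤ slideN w (pre (concatSeq z L) n) := by
      omega
    have hupper : slideN w (pre (concatSeq z L) n) ≤
        ∑ i ∈ Finset.range m, slideN w (L i) + m * w.length + (L m).length + w.length := by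
      omega
    have hlowerR : (∑ i ∈ Finset.range m, (slideN w (L i) : ℝ)) ≤
        slideN w (pre (concatSeq z L) n) := by exact_mod_cast hlower
    have hupperR : (slideN w (pre (concatSeq z L) n) : ℝ) ≤
        (∑ i ∈ Finset.range m, (slideN w (L i) : ℝ)) + m * w.length + (L m).length +
          w.length := by exact_mod_cast hupper
    have h1R : (cumLen L m : ℝ) ≤ n + 1 := by exact_mod_cast h1
    have h2R : (n : ℝ) + 1 ≤ cumLen L m + (L m).length := by
      have : n + 1 ≤ cumLen L m + (L m).length := h2.le
      exact_mod_cast this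
    have hmix := sum_mul_mixWeight z a τ w m hApos.ne'
    have hw0 : (0 : ℝ) ≤ w.length := Nat.cast_nonneg _
    have hmw0 : (0 : ℝ) ≤ w.length * m := by positivity
    have hLm0 : (0 : ℝ) ≤ (L m).length := Nat.cast_nonneg _
    set e1 := ∑ i ∈ Finset.range m, ((slideN w (L i) : ℝ) - a i * mixWeight z (τ i) w) with he1
    rw [Finset.sum_sub_distrib, hmix] at he1
    have hδm : δ m = |e1| + |(cumLen L m : ℝ) - A m| +
        w.length * m + (L m).length + (2 * w.length + 2) * 1 := rfl
    have habs1 := abs_nonneg e1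
    have habs2 := abs_nonneg ((cumLen L m : ℝ) - A m)
    have hb1 := neg_abs_le e1
    have hb2 := le_abs_self e1
    have hb3 := neg_abs_le ((cumLen L m : ℝ) - A m)
    have hb4 := le_abs_self ((cumLen L m : ℝ) - A m)
    have hmem := mixWeight_mem_Icc z (ht m) w
    have key := abs_div_sub_le (A := A m) (x := mixWeight z (t m) w)
      (r := slideN w (pre (concatSeq z L) n) - A m * mixWeight z (t m) w)
      (r' := ((n : ℝ) + 1) - w.length + 1 - A m) (δ := δ m) hApos hmem
      (by
        rw [abs_le, hδm]
        change e1 = _ - A m * mixWeight z (t m) w at he1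
        constructor <;> linarith)
      (by
        rw [abs_le, hδm]
        constructor <;> linarith) hδA
    rw [add_sub_cancel, add_sub_cancel] at key
    rw [Real.norm_eq_abs]
    have hlenpre : ((pre (concatSeq z L) n).length : ℝ) = n + 1 := by simp [pre]
    unfold slideP
    rw [hlenpre]
    exact key
  · intro ε hε
    exact hidxtop.eventually (hlow ε hε)
  · intro ε hε
    rw [Filter.frequently_atTop]
    intro N
    obtain ⟨m, hm, hle⟩ := Filter.frequently_atTop.1 (hup ε hε) (N + 1)
    have hge : m ≤ cumLen L m := hmono.id_le m
    refine ⟨cumLen L m - 1, by omega, ?_⟩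
    have : idx (cumLen L m - 1) = m := by
      have h1 := hidx1 (cumLen L m - 1)
      have h2 := hidx2 (cumLen L m - 1)
      rw [Nat.sub_add_cancel (by omega)] at h1 h2
      have h3 := hmono.le_iff_le.1 h1
      have h4 := hmono.lt_iff_lt.1 h2
      omega
    simp only [this]
    exact hle

end MixtureConcatenation

section Density

open scoped Classical in
lemma exists_set_weighted_density {a : ℕ → ℝ} (ha : ∀ i, 0 ≤ a i) (hmono : Monotone a) {θ : ℝ}
    (hθ : θ ∈ Set.Icc (0 : ℝ) 1) :
    ∃ G : Set ℕ, ∀ m, |∑ i ∈ Finset.range m, a i * (if i ∈ G then 1 else 0) -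
      θ * ∑ i ∈ Finset.range m, a i| ≤ a m := by
  set D : ℕ → ℝ := fun m =>
    Nat.rec 0 (fun i d => d + a i * ((if d ≤ 0 then 1 else 0) - θ)) m with hD
  have hstep : ∀ m, D (m + 1) = D m + a m * ((if D m ≤ 0 then 1 else 0) - θ) := fun m => rfl
  have hbound : ∀ m, |D m| ≤ a m := by
    intro m
    induction m with
    | zero => simpa [hD] using ha 0
    | succ m ih =>
      refine le_trans ?_ (hmono (Nat.le_succ m))
      rw [hstep]
      have h1 := abs_le.1 ih
      have h2 := mul_nonneg (ha m) hθ.1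
      have h3 := mul_nonneg (ha m) (sub_nonneg.2 hθ.2)
      rw [abs_le]
      split_ifs with h <;> constructor <;> nlinarith
  refine ⟨{i | D i ≤ 0}, fun m => ?_⟩
  refine le_trans (le_of_eq ?_) (hbound m)
  congr 1
  induction m with
  | zero => simp [hD]
  | succ m ih =>
    rw [Finset.sum_range_succ, Finset.sum_range_succ, hstep]
    simp only [Set.mem_ofPred_eq] at ih ⊢
    linear_combination ih

lemma mul_sum_range_le_sum_range_sq {a : ℕ → ℝ} (hmono : Monotone a) (q : ℕ) :
    (q : ℝ) * ∑ i ∈ Finset.range q, a i ≤ ∑ i ∈ Finset.range (q ^ 2), a i := by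
  rcases Nat.eq_zero_or_pos q with rfl | hq
  · simp
  have h1 : ∑ i ∈ Finset.range q, a i ≤ q * a q := by
    simpa using Finset.sum_le_card_nsmul (Finset.range q) a (a q)
      fun i hi => hmono (Finset.mem_range.1 hi).le
  have hle : q ≤ q ^ 2 := Nat.le_self_pow two_ne_zero q
  have h2 : ((q : ℝ) ^ 2 - q) * a q ≤ ∑ i ∈ Finset.Ico q (q ^ 2), a i := by
    have := Finset.card_nsmul_le_sum (Finset.Ico q (q ^ 2)) a (a q)
      fun i hi => hmono (Finset.mem_Ico.1 hi).1
    rwa [Nat.card_Ico, nsmul_eq_mul, Nat.cast_sub hle, Nat.cast_pow] at this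
  rw [← Finset.sum_range_add_sum_Ico _ hle]
  have hq1 : (1 : ℝ) ≤ q := by exact_mod_cast hq
  nlinarith [mul_le_mul_of_nonneg_left h1 (sub_nonneg.2 hq1)]

open scoped Classical in
lemma frequently_sum_ite_le {a : ℕ → ℝ} (ha : ∀ i, 0 ≤ a i) (hmono : Monotone a) {N : Set ℕ}
    (hN : ∃ᶠ r : ℕ in Filter.atTop, ∀ i, 2 ^ 2 ^ r ≤ i → i < 2 ^ 2 ^ (r + 1) → i ∉ N) {ε : ℝ}
    (hε : 0 < ε) :
    ∃ᶠ m in Filter.atTop, ∑ i ∈ Finset.range m, a i * (if i ∈ N then 1 else 0) ≤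
      ε * ∑ i ∈ Finset.range m, a i := by
  rw [Filter.frequently_atTop] at hN ⊢
  intro n
  obtain ⟨k, hk⟩ := exists_nat_gt (1 / ε)
  obtain ⟨r, hr, h⟩ := hN (max n k)
  have hrq : r < 2 ^ 2 ^ r := Nat.lt_two_pow_self.trans Nat.lt_two_pow_self
  set q := 2 ^ 2 ^ r with hq
  have hq2 : 2 ^ 2 ^ (r + 1) = q ^ 2 := by rw [hq, ← pow_mul, pow_succ]
  rw [hq2] at h
  have hle : q ≤ q ^ 2 := Nat.le_self_pow two_ne_zero q
  have hnk := max_le_iff.1 hr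
  refine ⟨q ^ 2, by omega, ?_⟩
  have h1 : ∑ i ∈ Finset.range (q ^ 2), a i * (if i ∈ N then 1 else 0) ≤
      ∑ i ∈ Finset.range q, a i := by
    rw [← Finset.sum_range_add_sum_Ico _ hle, Finset.sum_eq_zero (s := Finset.Ico q (q ^ 2)),
      add_zero]
    · refine Finset.sum_le_sum fun i _ => ?_
      have := ha i
      split_ifs <;> simp [this]
    · intro i hi
      rw [Finset.mem_Ico] at hi
      simp [h i hi.1 hi.2]
  have h2 := mul_sum_range_le_sum_range_sq hmono q
  have h3 : 1 ≤ ε * q := by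
    have hkq : (k : ℝ) ≤ q := by
      exact_mod_cast (show k ≤ q by omega)
    rw [div_lt_iff₀ hε] at hk
    nlinarith
  have h4 : 0 ≤ ∑ i ∈ Finset.range q, a i := Finset.sum_nonneg fun i _ => ha i
  nlinarith

open scoped Classical in
lemma exists_subset_limsup_density {a : ℕ → ℝ} (ha : ∀ i, 0 < a i) (hmono : Monotone a)
    (hsum : a =o[Filter.atTop] fun m => ∑ i ∈ Finset.range m, a i) {M : Set ℕ}
    (hM : ∃ᶠ r : ℕ in Filter.atTop, ∀ i, 2 ^ 2 ^ r ≤ i → i < 2 ^ 2 ^ (r + 1) → i ∈ M)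
    {s : ℝ} (hs : s ∈ Set.Icc (0 : ℝ) 1) :
    ∃ X ⊆ M, (∀ ε > 0, ∀ᶠ m in Filter.atTop,
        s - ε ≤ (∑ i ∈ Finset.range m, a i * (if i ∈ X then 0 else 1)) /
          ∑ i ∈ Finset.range m, a i) ∧
      (∀ ε > 0, ∃ᶠ m in Filter.atTop,
        (∑ i ∈ Finset.range m, a i * (if i ∈ X then 0 else 1)) /
          ∑ i ∈ Finset.range m, a i ≤ s + ε) := by
  obtain ⟨G, hG⟩ := exists_set_weighted_density (fun i => (ha i).le) hmono (θ := 1 - s)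
    ⟨sub_nonneg.2 hs.2, by linarith [hs.1]⟩
  have hsmall : ∀ ε > 0, ∀ᶠ m in Filter.atTop, a m ≤ ε * ∑ i ∈ Finset.range m, a i := by
    intro ε hε
    filter_upwards [hsum.def hε] with m hm
    rwa [Real.norm_of_nonneg (ha m).le,
      Real.norm_of_nonneg (Finset.sum_nonneg fun i _ => (ha i).le)] at hm
  have hpos : ∀ᶠ m in Filter.atTop, 0 < ∑ i ∈ Finset.range m, a i := by
    filter_upwards [Filter.eventually_gt_atTop 0] with m hm
    exact Finset.sum_pos (fun i _ => ha i) ⟨0, Finset.mem_range.2 hm⟩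
  have hsplit : ∀ m, ∑ i ∈ Finset.range m, a i =
      ∑ i ∈ Finset.range m, a i * (if i ∈ G then 0 else 1) +
        ∑ i ∈ Finset.range m, a i * (if i ∈ G then 1 else 0) := by
    intro m
    rw [← Finset.sum_add_distrib]
    refine Finset.sum_congr rfl fun i _ => ?_
    split_ifs <;> ring
  obtain ⟨X, hX⟩ : ∃ X, X = G ∩ M := ⟨_, rfl⟩
  obtain ⟨N, hN⟩ : ∃ N, N = Mᶜ := ⟨_, rfl⟩
  refine ⟨X, hX ▸ Set.inter_subset_right, fun ε hε => ?_, fun ε hε => ?_⟩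
  · filter_upwards [hsmall ε hε, hpos] with m h1 h2
    rw [le_div_iff₀ h2]
    have h3 := (abs_le.1 (hG m)).2
    have h4 : ∑ i ∈ Finset.range m, a i * (if i ∈ G then (0 : ℝ) else 1) ≤
        ∑ i ∈ Finset.range m, a i * (if i ∈ X then 0 else 1) := by
      refine Finset.sum_le_sum fun i _ => mul_le_mul_of_nonneg_left ?_ (ha i).le
      by_cases hi : i ∈ G <;> by_cases hi' : i ∈ M <;> simp [hX, hi, hi']
    have h5 := hsplit m
    nlinarith
  · refine ((frequently_sum_ite_le (fun i => (ha i).le) hmono (N := N)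
      (hM.mono fun r hr i h1 h2 => by simpa [hN] using hr i h1 h2)
      (half_pos hε)).and_eventually ((hsmall (ε / 2) (half_pos hε)).and hpos)).mono ?_
    rintro m ⟨h0, h1, h2⟩
    rw [div_le_iff₀ h2]
    have h3 := (abs_le.1 (hG m)).1
    have h4 : ∑ i ∈ Finset.range m, a i * (if i ∈ X then (0 : ℝ) else 1) ≤
        ∑ i ∈ Finset.range m, a i * (if i ∈ G then 0 else 1) +
          ∑ i ∈ Finset.range m, a i * (if i ∈ N then 1 else 0) := by
      rw [← Finset.sum_add_distrib]
      refine Finset.sum_le_sum fun i _ => ?_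
      rw [← mul_add]
      refine mul_le_mul_of_nonneg_left ?_ (ha i).le
      by_cases hi : i ∈ G <;> by_cases hi' : i ∈ M <;> simp [hX, hN, hi, hi']
    have h5 := hsplit m
    nlinarith

lemma log_log_eq {r i : ℕ} (h1 : 2 ^ 2 ^ r ≤ i) (h2 : i < 2 ^ 2 ^ (r + 1)) :
    Nat.log 2 (Nat.log 2 i) = r := by
  have hi : i ≠ 0 := fun h => by
    have : 0 < 2 ^ 2 ^ r := by positivity
    omega
  have h3 := Nat.le_log_of_pow_le (by norm_num) h1
  have h4 := Nat.log_lt_of_lt_pow hi h2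
  exact Nat.log_eq_of_pow_le_of_lt_pow h3 h4

open scoped Classical in
/-- Two disjoint sets whose upper densities, for the weights `a`, are the complements of
two given numbers. -/
lemma exists_disjoint_limsup_density {a : ℕ → ℝ} (ha : ∀ i, 0 < a i) (hmono : Monotone a)
    (hsum : a =o[Filter.atTop] fun m => ∑ i ∈ Finset.range m, a i)
    {s s' : ℝ} (hs : s ∈ Set.Icc (0 : ℝ) 1) (hs' : s' ∈ Set.Icc (0 : ℝ) 1) :
    ∃ X Y : Set ℕ, Disjoint X Y ∧
      ((∀ ε > 0, ∀ᶠ m in Filter.atTop,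
        s - ε ≤ (∑ i ∈ Finset.range m, a i * (if i ∈ X then 0 else 1)) /
          ∑ i ∈ Finset.range m, a i) ∧
      (∀ ε > 0, ∃ᶠ m in Filter.atTop,
        (∑ i ∈ Finset.range m, a i * (if i ∈ X then 0 else 1)) /
          ∑ i ∈ Finset.range m, a i ≤ s + ε)) ∧
      ((∀ ε > 0, ∀ᶠ m in Filter.atTop,
        s' - ε ≤ (∑ i ∈ Finset.range m, a i * (if i ∈ Y then 0 else 1)) /
          ∑ i ∈ Finset.range m, a i) ∧
      (∀ ε > 0, ∃ᶠ m in Filter.atTop,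
        (∑ i ∈ Finset.range m, a i * (if i ∈ Y then 0 else 1)) /
          ∑ i ∈ Finset.range m, a i ≤ s' + ε)) := by
  set M : Set ℕ := {i | Even (Nat.log 2 (Nat.log 2 i))} with hMdef
  obtain ⟨X, hX, hX'⟩ := exists_subset_limsup_density ha hmono hsum (M := M)
    (Filter.frequently_atTop.2 fun n => ⟨2 * n, by omega, fun i h1 h2 => by
      simp [hMdef, log_log_eq h1 h2]⟩) hs
  obtain ⟨Y, hY, hY'⟩ := exists_subset_limsup_density ha hmono hsum (M := Mᶜ)
    (Filter.frequently_atTop.2 fun n => ⟨2 * n + 1, by omega, fun i h1 h2 => by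
      simp [hMdef, log_log_eq h1 h2]⟩) hs'
  exact ⟨X, Y, (disjoint_compl_right (a := M)).mono hX hY, hX', hY'⟩

/-- The common asymptotic length of the digit strings in the construction. -/
def lengthWeight (j : ℕ) : ℝ := ((j : ℝ) + 2) ^ 2

lemma lengthWeight_pos (j : ℕ) : 0 < lengthWeight j := by
  unfold lengthWeight
  positivity

lemma lengthWeight_mono : Monotone lengthWeight := by
  intro i j h
  have : (i : ℝ) ≤ j := by exact_mod_cast h
  unfold lengthWeight
  gcongr

lemma one_isLittleO_lengthWeight :
    (fun _ : ℕ => (1 : ℝ)) =o[Filter.atTop] lengthWeight := by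
  rw [Asymptotics.isLittleO_const_left_of_ne one_ne_zero]
  refine Filter.tendsto_atTop_mono (fun j => ?_) tendsto_natCast_atTop_atTop
  rw [Real.norm_of_nonneg (lengthWeight_pos j).le, lengthWeight]
  nlinarith [Nat.cast_nonneg (α := ℝ) j]

lemma lengthWeight_isLittleO_sum :
    lengthWeight =o[Filter.atTop] fun m => ∑ i ∈ Finset.range m, lengthWeight i := by
  have hlow : ∀ m : ℕ, (m : ℝ) ^ 3 / 3 ≤ ∑ i ∈ Finset.range m, lengthWeight i := by
    intro m
    induction m with
    | zero => simp
    | succ m ih =>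
      rw [Finset.sum_range_succ]
      simp only [lengthWeight] at ih ⊢
      push_cast
      nlinarith [Nat.cast_nonneg (α := ℝ) m]
  rw [Asymptotics.isLittleO_iff]
  intro c hc
  obtain ⟨k, hk⟩ := exists_nat_gt (27 / c)
  filter_upwards [Filter.eventually_ge_atTop (max k 1)] with m hm
  have hmk := max_le_iff.1 hm
  have h1 : (1 : ℝ) ≤ m := by exact_mod_cast hmk.2
  have h2 : (k : ℝ) ≤ m := by exact_mod_cast hmk.1
  rw [Real.norm_of_nonneg (lengthWeight_pos m).le,
    Real.norm_of_nonneg (Finset.sum_nonneg fun i _ => (lengthWeight_pos i).le)]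
  rw [div_lt_iff₀ hc] at hk
  have h3 : 27 ≤ c * m := by nlinarith
  have h4 : lengthWeight m ≤ 9 * (m : ℝ) ^ 2 := by
    unfold lengthWeight
    nlinarith
  have h5 := mul_le_mul_of_nonneg_left (hlow m) hc.le
  nlinarith [mul_le_mul_of_nonneg_right h3 (sq_nonneg (m : ℝ))]

end Density

section SecondMoment

variable {α : Type*} [Fintype α] [DecidableEq α]

omit [DecidableEq α] in
lemma card_filter_eq_on {ι : Type*} [Fintype ι] [DecidableEq ι] (s : Finset ι) (v : ι → α)
    [DecidablePred fun u : ι → α => ∀ p ∈ s, u p = v p] :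
    (Finset.univ.filter fun u : ι → α => ∀ p ∈ s, u p = v p).card =
      Fintype.card α ^ (Fintype.card ι - s.card) := by
  have : (Finset.univ.filter fun u : ι → α => ∀ p ∈ s, u p = v p) =
      Fintype.piFinset fun p => if p ∈ s then {v p} else Finset.univ := by
    ext u
    simp only [Finset.mem_filter, Finset.mem_univ, true_and, Fintype.mem_piFinset]
    refine forall_congr' fun p => ?_
    split_ifs with h <;> simp [h]
  rw [this, Fintype.card_piFinset, ← Finset.card_compl, ← Finset.prod_const,
    ← Finset.prod_subset (Finset.subset_univ sᶜ)]
  · refine Finset.prod_congr rfl fun p hp => ?_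
    rw [if_neg (Finset.mem_compl.1 hp), Finset.card_univ]
  · intro p _ hp
    rw [Finset.mem_compl, not_not] at hp
    simp [hp]

/-- The positions of a window of length `l` starting at `i`. -/
def windowFinset (K l i : ℕ) : Finset (Fin K) :=
  Finset.univ.filter fun p => i ≤ (p : ℕ) ∧ (p : ℕ) < i + l

lemma card_windowFinset {K l i : ℕ} (h : i + l ≤ K) : (windowFinset K l i).card = l := by
  have : (windowFinset K l i).map Fin.valEmbedding = Finset.Ico i (i + l) := by
    ext p
    simp only [windowFinset, Finset.mem_map, Finset.mem_filter, Finset.mem_univ, true_and,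
      Fin.valEmbedding_apply, Finset.mem_Ico]
    constructor
    · rintro ⟨x, hx, rfl⟩
      exact hx
    · rintro ⟨h1, h2⟩
      exact ⟨⟨p, by omega⟩, ⟨h1, h2⟩, rfl⟩
  rw [← Finset.card_map Fin.valEmbedding, this, Nat.card_Ico]
  omega

omit [Fintype α] [DecidableEq α] in
lemma take_drop_ofFn_eq_iff (z : α) {K i : ℕ} (w : List α) (h : i + w.length ≤ K)
    (u : Fin K → α) :
    ((List.ofFn u).drop i).take w.length = w ↔
      ∀ p ∈ windowFinset K w.length i, u p = w.getD (p - i) z := by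
  constructor
  · intro hw p hp
    simp only [windowFinset, Finset.mem_filter, Finset.mem_univ, true_and] at hp
    have hlt : (p : ℕ) - i < w.length := by omega
    have h1 : w[(p : ℕ) - i]? = some (u p) := by
      conv_lhs => rw [← hw]
      rw [List.getElem?_take, if_pos hlt, List.getElem?_drop, Nat.add_sub_cancel' hp.1]
      simp
    rw [List.getD_eq_getElem?_getD, h1]
    rfl
  · intro hp
    refine List.ext_getElem ?_ fun k h1 h2 => ?_
    · simp only [List.length_take, List.length_drop, List.length_ofFn]
      omega
    · have := hp ⟨i + k, by omega⟩ (by simp [windowFinset]; omega)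
      simp only [List.getElem_take, List.getElem_drop, List.getElem_ofFn]
      rw [this]
      simp only [Nat.add_sub_cancel_left]
      exact List.getD_eq_getElem _ _ h2

/-- The word `w` occurs in `x` with frequency further than `ε` from the uniform one. -/
def IsBiased (w : List α) (ε : ℝ) (x : List α) : Prop :=
  ε * x.length < |(slideN w x : ℝ) - x.length * ((Fintype.card α : ℝ)⁻¹) ^ w.length|

variable [Nonempty α]

omit [DecidableEq α] in
lemma cast_card_pow_sub {K m : ℕ} (h : m ≤ K) :
    ((Fintype.card α ^ (K - m) : ℕ) : ℝ) =
      ((Fintype.card α : ℝ)⁻¹) ^ m * (Fintype.card α : ℝ) ^ K := by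
  have hB : (Fintype.card α : ℝ) ≠ 0 := by exact_mod_cast Fintype.card_ne_zero
  rw [Nat.cast_pow, pow_sub₀ _ hB h, inv_pow, mul_comm]

lemma sum_occurrence (w : List α) {K i : ℕ} (h : i + w.length ≤ K) :
    ∑ u : Fin K → α, (if ((List.ofFn u).drop i).take w.length = w then (1 : ℝ) else 0) =
      ((Fintype.card α : ℝ)⁻¹) ^ w.length * (Fintype.card α : ℝ) ^ K := by
  obtain ⟨z⟩ := ‹Nonempty α›
  have : Nonempty α := ⟨z⟩
  simp only [take_drop_ofFn_eq_iff z w h]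
  rw [Finset.sum_boole, card_filter_eq_on _ fun p : Fin K => w.getD (p - i) z,
    card_windowFinset h, Fintype.card_fin, cast_card_pow_sub (by omega)]

lemma sum_occurrence_mul_of_le (w : List α) {K i j : ℕ} (hij : i + w.length ≤ j)
    (hj : j + w.length ≤ K) :
    ∑ u : Fin K → α, (if ((List.ofFn u).drop i).take w.length = w then (1 : ℝ) else 0) *
        (if ((List.ofFn u).drop j).take w.length = w then (1 : ℝ) else 0) =
      (((Fintype.card α : ℝ)⁻¹) ^ w.length) ^ 2 * (Fintype.card α : ℝ) ^ K := by
  obtain ⟨z⟩ := ‹Nonempty α›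
  have : Nonempty α := ⟨z⟩
  simp only [take_drop_ofFn_eq_iff z w hj,
    take_drop_ofFn_eq_iff z w (show i + w.length ≤ K by omega)]
  have hdisj : Disjoint (windowFinset K w.length i) (windowFinset K w.length j) := by
    rw [Finset.disjoint_left]
    intro p h1 h2
    simp only [windowFinset, Finset.mem_filter, Finset.mem_univ, true_and] at h1 h2
    omega
  have hiff : ∀ u : Fin K → α,
      ((if ∀ p ∈ windowFinset K w.length i, u p = w.getD (p - i) z then (1 : ℝ) else 0) *
        (if ∀ p ∈ windowFinset K w.length j, u p = w.getD (p - j) z then (1 : ℝ) else 0)) =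
      if ∀ p ∈ windowFinset K w.length i ∪ windowFinset K w.length j,
        u p = (if (p : ℕ) < j then w.getD (p - i) z else w.getD (p - j) z) then 1 else 0 := by
    intro u
    rw [ite_zero_mul_ite_zero, mul_one]
    refine if_congr ?_ rfl rfl
    simp only [Finset.mem_union, or_imp, forall_and]
    refine and_congr (forall₂_congr fun p hp => ?_) (forall₂_congr fun p hp => ?_)
    · simp only [windowFinset, Finset.mem_filter, Finset.mem_univ, true_and] at hp
      rw [if_pos (by omega)]
    · simp only [windowFinset, Finset.mem_filter, Finset.mem_univ, true_and] at hp
      rw [if_neg (by omega)]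
  simp only [hiff]
  rw [Finset.sum_boole, card_filter_eq_on _ fun p : Fin K =>
      if (p : ℕ) < j then w.getD (p - i) z else w.getD (p - j) z,
    Finset.card_union_of_disjoint hdisj,
    card_windowFinset hj, card_windowFinset (by omega), Fintype.card_fin,
    cast_card_pow_sub (by omega), ← pow_mul, mul_two]

lemma sum_occurrence_mul_le (w : List α) {K i j : ℕ} (hi : i + w.length ≤ K)
    (hj : j + w.length ≤ K) :
    ∑ u : Fin K → α, (if ((List.ofFn u).drop i).take w.length = w then (1 : ℝ) else 0) *
        (if ((List.ofFn u).drop j).take w.length = w then (1 : ℝ) else 0) ≤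
      (((Fintype.card α : ℝ)⁻¹) ^ w.length) ^ 2 * (Fintype.card α : ℝ) ^ K +
        (if j < i + w.length ∧ i < j + w.length then (Fintype.card α : ℝ) ^ K else 0) := by
  rcases le_or_gt (i + w.length) j with h | h
  · rw [sum_occurrence_mul_of_le w h hj, if_neg (by omega), add_zero]
  rcases le_or_gt (j + w.length) i with h' | h'
  · simp only [mul_comm (if ((List.ofFn _).drop i).take w.length = w then (1 : ℝ) else 0)]
    rw [sum_occurrence_mul_of_le w h' hi, if_neg (by omega), add_zero]
  · rw [if_pos ⟨h, h'⟩]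
    have h1 : ∑ u : Fin K → α,
        (if ((List.ofFn u).drop i).take w.length = w then (1 : ℝ) else 0) *
        (if ((List.ofFn u).drop j).take w.length = w then (1 : ℝ) else 0) ≤
        ∑ _u : Fin K → α, (1 : ℝ) := by
      refine Finset.sum_le_sum fun u _ => ?_
      split_ifs <;> norm_num
    have h2 : ∑ _u : Fin K → α, (1 : ℝ) = (Fintype.card α : ℝ) ^ K := by simp
    have h3 : 0 ≤ (((Fintype.card α : ℝ)⁻¹) ^ w.length) ^ 2 * (Fintype.card α : ℝ) ^ K := by
      positivity
    linarith

omit [Fintype α] [Nonempty α] in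
lemma slideN_ofFn (w : List α) {K : ℕ} (u : Fin K → α) :
    (slideN w (List.ofFn u) : ℝ) = ∑ i ∈ Finset.range (K + 1 - w.length),
      (if ((List.ofFn u).drop i).take w.length = w then (1 : ℝ) else 0) := by
  rw [Finset.sum_boole, slideN, List.length_ofFn]

lemma card_near_le (T l i : ℕ) :
    ((Finset.range T).filter fun j => j < i + l ∧ i < j + l).card ≤ 2 * l := by
  have : ((Finset.range T).filter fun j => j < i + l ∧ i < j + l) ⊆
      Finset.Ico (i - l) (i + l) := by
    intro j hj
    rw [Finset.mem_filter] at hj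
    rw [Finset.mem_Ico]
    omega
  refine (Finset.card_le_card this).trans ?_
  rw [Nat.card_Ico]
  omega

lemma sum_sq_slideN_sub_le (w : List α) (K : ℕ) :
    ∑ u : Fin K → α, ((slideN w (List.ofFn u) : ℝ) -
        (K + 1 - w.length : ℕ) * ((Fintype.card α : ℝ)⁻¹) ^ w.length) ^ 2 ≤
      2 * w.length * (K + 1 - w.length : ℕ) * (Fintype.card α : ℝ) ^ K := by
  set T := K + 1 - w.length with hT
  set q := ((Fintype.card α : ℝ)⁻¹) ^ w.length with hq
  set X : ℕ → (Fin K → α) → ℝ := fun i u =>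
    if ((List.ofFn u).drop i).take w.length = w then (1 : ℝ) else 0 with hX
  have hexp : ∀ u : Fin K → α, ((slideN w (List.ofFn u) : ℝ) - T * q) ^ 2 =
      ∑ i ∈ Finset.range T, ∑ j ∈ Finset.range T, (X i u - q) * (X j u - q) := by
    intro u
    rw [← Finset.sum_mul_sum, slideN_ofFn, sq, Finset.sum_sub_distrib]
    simp [hX, hT]
  have hwin : ∀ i ∈ Finset.range T, i + w.length ≤ K := fun i hi => by
    rw [Finset.mem_range] at hi
    omega
  calc ∑ u : Fin K → α, ((slideN w (List.ofFn u) : ℝ) - T * q) ^ 2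
      = ∑ i ∈ Finset.range T, ∑ j ∈ Finset.range T, ∑ u : Fin K → α,
          (X i u - q) * (X j u - q) := by
        simp only [hexp]
        rw [Finset.sum_comm]
        refine Finset.sum_congr rfl fun i _ => ?_
        rw [Finset.sum_comm]
    _ ≤ ∑ i ∈ Finset.range T, ∑ j ∈ Finset.range T,
          (if j < i + w.length ∧ i < j + w.length then (Fintype.card α : ℝ) ^ K else 0) := by
        refine Finset.sum_le_sum fun i hi => Finset.sum_le_sum fun j hj => ?_
        have h1 := sum_occurrence_mul_le w (hwin i hi) (hwin j hj)
        have h2 := sum_occurrence w (hwin i hi)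
        have h3 := sum_occurrence w (hwin j hj)
        have h4 : ∑ u : Fin K → α, (X i u - q) * (X j u - q) =
            ∑ u : Fin K → α, X i u * X j u - q * ∑ u : Fin K → α, X j u -
              q * ∑ u : Fin K → α, X i u + q ^ 2 * (Fintype.card α : ℝ) ^ K := by
          have h5 : q ^ 2 * (Fintype.card α : ℝ) ^ K = ∑ _u : Fin K → α, q ^ 2 := by
            simp [mul_comm]
          rw [h5, Finset.mul_sum, Finset.mul_sum, ← Finset.sum_sub_distrib,
            ← Finset.sum_sub_distrib, ← Finset.sum_add_distrib]
          refine Finset.sum_congr rfl fun u _ => ?_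
          ring
        rw [h4, h2, h3]
        refine le_trans (add_le_add_left (sub_le_sub_right (sub_le_sub_right h1 _) _) _) ?_
        apply le_of_eq
        ring
    _ ≤ ∑ _i ∈ Finset.range T, 2 * (w.length : ℝ) * (Fintype.card α : ℝ) ^ K := by
        refine Finset.sum_le_sum fun i _ => ?_
        rw [← Finset.sum_filter, Finset.sum_const, nsmul_eq_mul]
        refine mul_le_mul_of_nonneg_right ?_ (by positivity)
        exact_mod_cast card_near_le T w.length i
    _ = 2 * w.length * T * (Fintype.card α : ℝ) ^ K := by
        rw [Finset.sum_const, Finset.card_range, nsmul_eq_mul]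
        ring

open scoped Classical in
lemma card_isBiased_le (w : List α) {ε : ℝ} (hε : 0 < ε) {K : ℕ} (hK : 0 < K) :
    ((Finset.univ.filter fun u : Fin K → α => IsBiased w ε (List.ofFn u)).card : ℝ) ≤
      (6 * (w.length + 1 : ℝ) ^ 2 / ε ^ 2) * ((Fintype.card α : ℝ) ^ K / K) := by
  set q := ((Fintype.card α : ℝ)⁻¹) ^ w.length with hq
  have hq0 : 0 ≤ q := by positivity
  have hq1 : q ≤ 1 := by
    refine pow_le_one₀ (by positivity) (inv_le_one_of_one_le₀ ?_)
    exact_mod_cast Fintype.card_pos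
  have hK1 : (1 : ℝ) ≤ K := by exact_mod_cast hK
  have hl : (0 : ℝ) ≤ w.length := Nat.cast_nonneg _
  set T := K + 1 - w.length with hT
  have hTK1 : |(T : ℝ) - K| ≤ w.length + 1 := by
    rw [abs_le]
    have h1 : (K : ℝ) ≤ T + w.length := by exact_mod_cast (show K ≤ T + w.length by omega)
    have h2 : (T : ℝ) ≤ K + 1 := by exact_mod_cast (show T ≤ K + 1 by omega)
    constructor <;> linarith
  have hTK2 : (T : ℝ) ≤ 2 * K := by exact_mod_cast (show T ≤ 2 * K by omega)
  have hBK : 0 ≤ (Fintype.card α : ℝ) ^ K := by positivity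
  have hmoment : ∑ u : Fin K → α, ((slideN w (List.ofFn u) : ℝ) - K * q) ^ 2 ≤
      6 * (w.length + 1 : ℝ) ^ 2 * K * (Fintype.card α : ℝ) ^ K := by
    have hone : ∀ u : Fin K → α, ((slideN w (List.ofFn u) : ℝ) - K * q) ^ 2 ≤
        2 * ((slideN w (List.ofFn u) : ℝ) - T * q) ^ 2 + 2 * (w.length + 1 : ℝ) ^ 2 := by
      intro u
      have h1 : (((T : ℝ) - K) * q) ^ 2 ≤ (w.length + 1 : ℝ) ^ 2 := by
        rw [sq_le_sq, abs_mul, abs_of_nonneg hq0,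
          abs_of_nonneg (by positivity : (0 : ℝ) ≤ w.length + 1)]
        exact (mul_le_of_le_one_right (abs_nonneg _) hq1).trans hTK1
      nlinarith [sq_nonneg (((slideN w (List.ofFn u) : ℝ) - T * q) - ((T : ℝ) - K) * q)]
    refine (Finset.sum_le_sum fun u _ => hone u).trans ?_
    rw [Finset.sum_add_distrib, ← Finset.mul_sum, Finset.sum_const, Finset.card_univ,
      Fintype.card_fun, Fintype.card_fin, nsmul_eq_mul, Nat.cast_pow]
    have h1 := sum_sq_slideN_sub_le w K
    rw [← hT, ← hq] at h1
    have h2 : 2 * (2 * w.length * T) + 2 * (w.length + 1 : ℝ) ^ 2 ≤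
        6 * (w.length + 1 : ℝ) ^ 2 * K := by
      nlinarith [mul_le_mul_of_nonneg_left hTK2 hl, mul_nonneg (sq_nonneg (w.length - 1 : ℝ))
        (Nat.cast_nonneg (α := ℝ) K), mul_nonneg (sq_nonneg (w.length + 1 : ℝ))
        (sub_nonneg.2 hK1)]
    nlinarith [mul_le_mul_of_nonneg_right h2 hBK]
  set S := Finset.univ.filter fun u : Fin K → α => IsBiased w ε (List.ofFn u) with hS
  have hcheb : (S.card : ℝ) * (ε * K) ^ 2 ≤
      ∑ u : Fin K → α, ((slideN w (List.ofFn u) : ℝ) - K * q) ^ 2 := by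
    rw [← nsmul_eq_mul, ← Finset.sum_const]
    refine (Finset.sum_le_sum fun u hu => ?_).trans
      (Finset.sum_le_univ_sum_of_nonneg fun u => sq_nonneg _)
    rw [hS, Finset.mem_filter, IsBiased, List.length_ofFn] at hu
    rw [← sq_abs ((slideN w (List.ofFn u) : ℝ) - K * q)]
    exact pow_le_pow_left₀ (by positivity) hu.2.le 2
  have h := hcheb.trans hmoment
  have e : (6 * (w.length + 1 : ℝ) ^ 2 / ε ^ 2) * ((Fintype.card α : ℝ) ^ K / K) =
      6 * (w.length + 1 : ℝ) ^ 2 * K * (Fintype.card α : ℝ) ^ K / (ε * K) ^ 2 := by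
    field_simp
  rw [e, le_div_iff₀ (by positivity)]
  exact h

end SecondMoment

section Digits

variable {b : ℕ}

lemma digitsFin_length (hb : 0 < b) (n : ℕ) :
    (digitsFin b hb n).length = (Nat.digits b n).length := by
  simp [digitsFin]

lemma digitsFin_length_of_mem (hb : 2 ≤ b) {n k : ℕ} (h1 : b ^ k ≤ n) (h2 : n < b ^ (k + 1)) :
    (digitsFin b (two_pos.trans_le hb) n).length = k + 1 := by
  have h0 : n ≠ 0 := by
    have := Nat.pow_pos (n := k) (show 0 < b by omega)
    omega
  rw [digitsFin_length, Nat.length_digits b n (by omega) h0,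
    Nat.log_eq_of_pow_le_of_lt_pow h1 h2]

lemma digitsFin_injective (hb : 2 ≤ b) :
    Function.Injective (digitsFin b (two_pos.trans_le hb)) := by
  intro m n h
  have hval : ∀ n,
      (digitsFin b (two_pos.trans_le hb) n).map Fin.val = (Nat.digits b n).reverse := by
    intro n
    rw [digitsFin, List.map_map]
    conv_rhs => rw [← List.map_id (Nat.digits b n).reverse]
    refine List.map_congr_left fun d hd => ?_
    exact Nat.mod_eq_of_lt (Nat.digits_lt_base (by omega) (List.mem_reverse.1 hd))
  have h1 := congrArg (List.map Fin.val) h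
  rw [hval, hval, List.reverse_inj] at h1
  exact Nat.digits_inj_iff.1 h1

lemma digitsFin_pow (hb : 2 ≤ b) (k : ℕ) :
    digitsFin b (two_pos.trans_le hb) (b ^ k) =
      ⟨1, by omega⟩ :: List.replicate k ⟨0, two_pos.trans_le hb⟩ := by
  have h : Nat.digits b (b ^ k) = List.replicate k 0 ++ [1] := by
    have := Nat.digits_base_pow_mul (b := b) (k := k) (m := 1) (by omega) one_pos
    rwa [mul_one, Nat.digits_of_lt b 1 one_ne_zero (by omega)] at this
  simp [digitsFin, h, Nat.mod_eq_of_lt (show 1 < b by omega)]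

open scoped Classical in
lemma card_biased_integers_le (hb : 2 ≤ b) (w : List (Fin b)) {ε : ℝ} (hε : 0 < ε) {K : ℕ}
    (hK : 0 < K) :
    (((Finset.Ico (b ^ (K - 1)) (b ^ K)).filter fun n =>
        IsBiased w ε (digitsFin b (two_pos.trans_le hb) n)).card : ℝ) ≤
      (6 * (w.length + 1 : ℝ) ^ 2 / ε ^ 2) * ((b : ℝ) ^ K / K) := by
  have : Nonempty (Fin b) := ⟨⟨0, two_pos.trans_le hb⟩⟩
  have h := card_isBiased_le w hε hK
  rw [Fintype.card_fin] at h
  refine le_trans ?_ h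
  have hlen : ∀ n ∈ Finset.Ico (b ^ (K - 1)) (b ^ K),
      (digitsFin b (two_pos.trans_le hb) n).length = K := fun n hn => by
    rw [Finset.mem_Ico] at hn
    have := digitsFin_length_of_mem hb hn.1 (by
      rw [Nat.sub_add_cancel hK]
      exact hn.2)
    rwa [Nat.sub_add_cancel hK] at this
  set f : ℕ → Fin K → Fin b := fun n i =>
    (digitsFin b (two_pos.trans_le hb) n).getD i ⟨0, two_pos.trans_le hb⟩ with hf
  have hfn : ∀ n ∈ Finset.Ico (b ^ (K - 1)) (b ^ K),
      List.ofFn (f n) = digitsFin b (two_pos.trans_le hb) n := by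
    intro n hn
    refine List.ext_getElem (by simp [hlen n hn]) fun i h1 h2 => ?_
    rw [List.getElem_ofFn]
    exact List.getD_eq_getElem _ _ h2
  have hcard := Finset.card_le_card_of_injOn
    (s := (Finset.Ico (b ^ (K - 1)) (b ^ K)).filter fun n =>
      IsBiased w ε (digitsFin b (two_pos.trans_le hb) n))
    (t := Finset.univ.filter fun u : Fin K → Fin b => IsBiased w ε (List.ofFn u)) f
    (fun n hn => by
      rw [Finset.mem_coe, Finset.mem_filter] at hn ⊢
      refine ⟨Finset.mem_univ _, ?_⟩
      rw [hfn n hn.1]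
      exact hn.2)
    (fun m hm n hn hmn => by
      rw [Finset.mem_coe, Finset.mem_filter] at hm hn
      apply digitsFin_injective hb
      rw [← hfn m hm.1, ← hfn n hn.1, hmn])
  exact_mod_cast hcard

/-- Every nonempty word has asymptotically the uniform frequency along the sequence of strings. -/
def IsUnbiasedSeq {α : Type*} [Fintype α] [DecidableEq α] (x : ℕ → List α) : Prop :=
  ∀ w : List α, ∀ ε : ℝ, 0 < ε → ∀ᶠ j in Filter.atTop, ¬ IsBiased w ε (x j)

open MeasureTheory in
lemma ae_isUnbiasedSeq (hb : 2 ≤ b) {I : Set ℝ} {g : ℕ → ℝ → ℕ} {K : ℕ → ℕ} {M : ℝ}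
    (hM : 0 ≤ M) (hK : ∀ j, (j + 1) ^ 2 ≤ K j)
    (hg : ∀ j, ∀ c ∈ I, b ^ (K j - 1) ≤ g j c ∧ g j c < b ^ K j)
    (hfib : ∀ j n, b ^ (K j - 1) ≤ n →
      volume {c ∈ I | g j c = n} ≤ ENNReal.ofReal (M / (b : ℝ) ^ K j)) :
    ∀ᵐ c, c ∈ I → IsUnbiasedSeq fun j => digitsFin b (two_pos.trans_le hb) (g j c) := by
  classical
  have hb0 : (0 : ℝ) < b := by exact_mod_cast (show 0 < b by omega)
  have key : ∀ (w : List (Fin b)) (m : ℕ), ∀ᵐ c, ∀ᶠ j in Filter.atTop,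
      c ∉ {c ∈ I | IsBiased w (1 / ((m : ℝ) + 1)) (digitsFin b (two_pos.trans_le hb) (g j c))} := by
    intro w m
    have hε : (0 : ℝ) < 1 / ((m : ℝ) + 1) := by positivity
    set C := 6 * (w.length + 1 : ℝ) ^ 2 / (1 / ((m : ℝ) + 1)) ^ 2 with hC
    have hC0 : 0 ≤ C := by positivity
    have hbound : ∀ j, volume {c ∈ I | IsBiased w (1 / ((m : ℝ) + 1))
        (digitsFin b (two_pos.trans_le hb) (g j c))} ≤
        ENNReal.ofReal (C * M * (1 / ((j + 1 : ℕ) : ℝ) ^ 2)) := by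
      intro j
      have hKpos : 0 < K j := lt_of_lt_of_le (by positivity) (hK j)
      set S := (Finset.Ico (b ^ (K j - 1)) (b ^ K j)).filter fun n =>
        IsBiased w (1 / ((m : ℝ) + 1)) (digitsFin b (two_pos.trans_le hb) n) with hS
      have hcard := card_biased_integers_le hb w hε hKpos
      rw [← hS, ← hC] at hcard
      have hsub : {c ∈ I | IsBiased w (1 / ((m : ℝ) + 1))
          (digitsFin b (two_pos.trans_le hb) (g j c))} ⊆
          ⋃ n ∈ S, {c ∈ I | g j c = n} := by
        rintro c ⟨hc, hbias⟩
        simp only [Set.mem_iUnion, exists_prop]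
        refine ⟨g j c, ?_, hc, rfl⟩
        rw [hS, Finset.mem_filter, Finset.mem_Ico]
        exact ⟨hg j c hc, hbias⟩
      calc volume {c ∈ I | IsBiased w (1 / ((m : ℝ) + 1))
            (digitsFin b (two_pos.trans_le hb) (g j c))}
          ≤ ∑ n ∈ S, volume {c ∈ I | g j c = n} :=
            (measure_mono hsub).trans (measure_biUnion_finset_le _ _)
        _ ≤ ∑ _n ∈ S, ENNReal.ofReal (M / (b : ℝ) ^ K j) := by
            refine Finset.sum_le_sum fun n hn => hfib j n ?_
            rw [hS, Finset.mem_filter, Finset.mem_Ico] at hn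
            exact hn.1.1
        _ = ENNReal.ofReal (S.card * (M / (b : ℝ) ^ K j)) := by
            rw [Finset.sum_const, nsmul_eq_mul, ENNReal.ofReal_mul (Nat.cast_nonneg _),
              ENNReal.ofReal_natCast]
        _ ≤ ENNReal.ofReal (C * M * (1 / ((j + 1 : ℕ) : ℝ) ^ 2)) := by
            refine ENNReal.ofReal_le_ofReal ?_
            have hKj : ((j + 1 : ℕ) : ℝ) ^ 2 ≤ K j := by exact_mod_cast hK j
            calc (S.card : ℝ) * (M / (b : ℝ) ^ K j)
                ≤ C * ((b : ℝ) ^ K j / K j) * (M / (b : ℝ) ^ K j) := by gcongr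
              _ = C * M * (1 / K j) := by field_simp
              _ ≤ C * M * (1 / ((j + 1 : ℕ) : ℝ) ^ 2) := by gcongr
    refine ae_eventually_notMem (ne_top_of_le_ne_top ?_ (ENNReal.tsum_le_tsum hbound))
    have hsum : Summable fun j : ℕ => C * M * (1 / ((j + 1 : ℕ) : ℝ) ^ 2) :=
      ((summable_nat_add_iff 1).2 (Real.summable_one_div_nat_pow.2 one_lt_two)).mul_left _
    exact hsum.tsum_ofReal_ne_top
  filter_upwards [ae_all_iff.2 fun w => ae_all_iff.2 (key w)] with c hc hcI w ε hε
  obtain ⟨m, hm⟩ := exists_nat_one_div_lt hε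
  filter_upwards [hc w m] with j hj hbias
  refine hj ⟨hcI, lt_of_le_of_lt ?_ hbias⟩
  exact mul_le_mul_of_nonneg_right hm.le (Nat.cast_nonneg _)

end Digits

section Rounding

open MeasureTheory

lemma exists_mem_Ioo_of_ae {P : ℝ → Prop} {u v : ℝ} (huv : u < v)
    (h : ∀ᵐ c, c ∈ Set.Ioo u v → P c) : ∃ c ∈ Set.Ioo u v, P c := by
  by_contra! hne
  have hnull : volume (Set.Ioo u v) = 0 := by
    refine measure_mono_null ?_ (ae_iff.1 h)
    intro c hc hP
    exact hne c hc (hP hc)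
  rw [Real.volume_Ioo, ENNReal.ofReal_eq_zero] at hnull
  linarith

lemma volume_floor_fiber_le {I : Set ℝ} (hI : ∀ y ∈ I, 0 ≤ y) {R : ℝ} (hR : 0 < R) (n : ℕ) :
    volume {y ∈ I | ⌊y * R⌋₊ = n} ≤ ENNReal.ofReal (1 / R) := by
  have hsub : {y ∈ I | ⌊y * R⌋₊ = n} ⊆ Set.Icc (n / R) ((n + 1) / R) := by
    rintro y ⟨hy, rfl⟩
    rw [Set.mem_Icc, div_le_iff₀ hR, le_div_iff₀ hR]
    exact ⟨Nat.floor_le (mul_nonneg (hI y hy) hR.le), (Nat.lt_floor_add_one _).le⟩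
  refine (measure_mono hsub).trans ?_
  rw [Real.volume_Icc]
  refine ENNReal.ofReal_le_ofReal (le_of_eq ?_)
  ring

lemma volume_ceil_div_fiber_le {I : Set ℝ} (hI : ∀ c ∈ I, 0 < c) {R : ℝ} (hR : 2 ≤ R) {n : ℕ}
    (hn : R ≤ n) :
    volume {c ∈ I | ⌈R / c⌉₊ = n} ≤ ENNReal.ofReal (2 / R) := by
  have hR0 : 0 < R := by linarith
  have hn1 : 0 < (n : ℝ) - 1 := by linarith
  have hn0 : 0 < (n : ℝ) := by linarith
  have hsub : {c ∈ I | ⌈R / c⌉₊ = n} ⊆ Set.Icc (R / n) (R / (n - 1)) := by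
    rintro c ⟨hc, hcn⟩
    have hc0 := hI c hc
    have h1 : R / c ≤ n := hcn ▸ Nat.le_ceil _
    have h2 : (n : ℝ) < R / c + 1 := hcn ▸ Nat.ceil_lt_add_one (by positivity)
    rw [div_le_iff₀ hc0] at h1
    rw [← sub_lt_iff_lt_add, lt_div_iff₀ hc0] at h2
    rw [Set.mem_Icc, div_le_iff₀ hn0, le_div_iff₀ hn1]
    constructor <;> linarith
  refine (measure_mono hsub).trans ?_
  rw [Real.volume_Icc]
  refine ENNReal.ofReal_le_ofReal ?_
  rw [div_sub_div _ _ hn1.ne' hn0.ne', div_le_div_iff₀ (by positivity) hR0]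
  nlinarith [mul_nonneg (sub_nonneg.2 hn) hn0.le, mul_nonneg (sub_nonneg.2 hn) hR0.le]

lemma volume_ceil_floor_fiber_le {I : Set ℝ} (hI : ∀ y ∈ I, 0 ≤ y) {c R : ℝ} (hc : 0 < c)
    (hc1 : c ≤ 1) (hR : 0 < R) (n : ℕ) :
    volume {y ∈ I | ⌈(⌊y * R⌋₊ : ℝ) / c⌉₊ = n} ≤ ENNReal.ofReal (2 / R) := by
  have hsub : {y ∈ I | ⌈(⌊y * R⌋₊ : ℝ) / c⌉₊ = n} ⊆
      Set.Icc (c * (n - 1) / R) ((c * n + 1) / R) := by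
    rintro y ⟨hy, hyn⟩
    have h1 : (⌊y * R⌋₊ : ℝ) / c ≤ n := hyn ▸ Nat.le_ceil _
    have h2 : (n : ℝ) < (⌊y * R⌋₊ : ℝ) / c + 1 := hyn ▸ Nat.ceil_lt_add_one (by positivity)
    rw [div_le_iff₀ hc] at h1
    rw [← sub_lt_iff_lt_add, lt_div_iff₀ hc] at h2
    have h3 := Nat.floor_le (mul_nonneg (hI y hy) hR.le)
    have h4 := Nat.lt_floor_add_one (y * R)
    rw [Set.mem_Icc, div_le_iff₀ hR, le_div_iff₀ hR]
    constructor <;> linarith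
  refine (measure_mono hsub).trans ?_
  rw [Real.volume_Icc, ← sub_div]
  refine ENNReal.ofReal_le_ofReal ?_
  gcongr
  linarith

variable {b : ℕ}

lemma sixteen_le_pow (hb : 2 ≤ b) (j : ℕ) : 16 ≤ b ^ (j + 2) ^ 2 :=
  calc 16 = 2 ^ 4 := by norm_num
    _ ≤ b ^ 4 := Nat.pow_le_pow_left hb 4
    _ ≤ b ^ (j + 2) ^ 2 := Nat.pow_le_pow_right (by omega)
      (Nat.pow_le_pow_left (show 2 ≤ j + 2 by omega) 2)

lemma floor_mul_mem (hb : 2 ≤ b) {c : ℝ} (hc : c ∈ Set.Ioo (3 / 4 : ℝ) 1) (j : ℕ) :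
    b ^ ((j + 2) ^ 2 - 1) ≤ ⌊c * (b : ℝ) ^ (j + 2) ^ 2⌋₊ ∧
      ⌊c * (b : ℝ) ^ (j + 2) ^ 2⌋₊ < b ^ (j + 2) ^ 2 := by
  have hR : (16 : ℝ) ≤ (b : ℝ) ^ (j + 2) ^ 2 := by exact_mod_cast sixteen_le_pow hb j
  have hb' : (2 : ℝ) ≤ b := by exact_mod_cast hb
  constructor
  · refine Nat.le_floor ?_
    have h1 : (b : ℝ) ^ (j + 2) ^ 2 = b * (b : ℝ) ^ ((j + 2) ^ 2 - 1) := by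
      rw [← pow_succ', Nat.sub_add_cancel (Nat.one_le_pow _ _ (by omega))]
    have h2 : (0 : ℝ) < (b : ℝ) ^ ((j + 2) ^ 2 - 1) := by positivity
    push_cast
    rw [h1]
    nlinarith [hc.1, mul_le_mul_of_nonneg_right hb' h2.le,
      mul_le_mul_of_nonneg_right hc.1.le (by positivity : 0 ≤ b * (b : ℝ) ^ ((j + 2) ^ 2 - 1))]
  · rw [Nat.floor_lt (by nlinarith [hc.1])]
    push_cast
    nlinarith [hc.2]

lemma ceil_div_mem (hb : 2 ≤ b) {c x : ℝ} (hc : c ∈ Set.Ioo (3 / 4 : ℝ) 1) {j : ℕ}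
    (hx : (b : ℝ) ^ (j + 2) ^ 2 ≤ x) (hx' : x ≤ 5 / 4 * (b : ℝ) ^ (j + 2) ^ 2) :
    b ^ (j + 2) ^ 2 ≤ ⌈x / c⌉₊ ∧ ⌈x / c⌉₊ < b ^ ((j + 2) ^ 2 + 1) := by
  have hR : (16 : ℝ) ≤ (b : ℝ) ^ (j + 2) ^ 2 := by exact_mod_cast sixteen_le_pow hb j
  have hb' : (2 : ℝ) ≤ b := by exact_mod_cast hb
  have hc0 : 0 < c := by linarith [hc.1]
  have h1 : x ≤ x / c := by
    rw [le_div_iff₀ hc0]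
    nlinarith [hc.2]
  have h2 : x / c ≤ 4 / 3 * x := by
    rw [div_le_iff₀ hc0]
    nlinarith [hc.1]
  have h3 := Nat.ceil_lt_add_one (show 0 ≤ x / c by linarith)
  have h4 := Nat.le_ceil (x / c)
  constructor
  · have : ((b ^ (j + 2) ^ 2 : ℕ) : ℝ) ≤ ⌈x / c⌉₊ := by
      push_cast
      linarith
    exact_mod_cast this
  · have : (⌈x / c⌉₊ : ℝ) < (b ^ ((j + 2) ^ 2 + 1) : ℕ) := by
      push_cast
      rw [pow_succ (b : ℝ) ((j + 2) ^ 2)]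
      nlinarith
    exact_mod_cast this

lemma cast_floor_mul_mem (hb : 2 ≤ b) {y : ℝ} (hy : y ∈ Set.Ioo (1 : ℝ) (5 / 4)) (j : ℕ) :
    (b : ℝ) ^ (j + 2) ^ 2 ≤ (⌊y * (b : ℝ) ^ (j + 2) ^ 2⌋₊ : ℝ) ∧
      (⌊y * (b : ℝ) ^ (j + 2) ^ 2⌋₊ : ℝ) ≤ 5 / 4 * (b : ℝ) ^ (j + 2) ^ 2 := by
  have hR : (16 : ℝ) ≤ (b : ℝ) ^ (j + 2) ^ 2 := by exact_mod_cast sixteen_le_pow hb j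
  constructor
  · have : b ^ (j + 2) ^ 2 ≤ ⌊y * (b : ℝ) ^ (j + 2) ^ 2⌋₊ := by
      refine Nat.le_floor ?_
      push_cast
      nlinarith [hy.1]
    exact_mod_cast this
  · refine (Nat.floor_le (by nlinarith [hy.1])).trans ?_
    nlinarith [hy.2]

lemma natFloor_mul_mem (hb : 2 ≤ b) {y : ℝ} (hy : y ∈ Set.Ioo (1 : ℝ) (5 / 4)) (j : ℕ) :
    b ^ (j + 2) ^ 2 ≤ ⌊y * (b : ℝ) ^ (j + 2) ^ 2⌋₊ ∧
      ⌊y * (b : ℝ) ^ (j + 2) ^ 2⌋₊ < b ^ ((j + 2) ^ 2 + 1) := by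
  have h := cast_floor_mul_mem hb hy j
  have hR : (16 : ℝ) ≤ (b : ℝ) ^ (j + 2) ^ 2 := by exact_mod_cast sixteen_le_pow hb j
  have hb' : (2 : ℝ) ≤ b := by exact_mod_cast hb
  refine ⟨by exact_mod_cast h.1, ?_⟩
  have : (⌊y * (b : ℝ) ^ (j + 2) ^ 2⌋₊ : ℝ) < (b ^ ((j + 2) ^ 2 + 1) : ℕ) := by
    push_cast
    rw [pow_succ (b : ℝ) ((j + 2) ^ 2)]
    nlinarith
  exact_mod_cast this

lemma exists_slope (hb : 2 ≤ b) : ∃ c ∈ Set.Ioo (3 / 4 : ℝ) 1,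
    (IsUnbiasedSeq fun j : ℕ => digitsFin b (two_pos.trans_le hb) ⌊c * (b : ℝ) ^ (j + 2) ^ 2⌋₊) ∧
    IsUnbiasedSeq fun j : ℕ => digitsFin b (two_pos.trans_le hb) ⌈(b : ℝ) ^ (j + 2) ^ 2 / c⌉₊ := by
  have hb0 : (b : ℝ) ≠ 0 := by exact_mod_cast (show b ≠ 0 by omega)
  have hR : ∀ j : ℕ, (16 : ℝ) ≤ (b : ℝ) ^ (j + 2) ^ 2 := fun j => by
    exact_mod_cast sixteen_le_pow hb j
  have h1 := ae_isUnbiasedSeq hb (I := Set.Ioo (3 / 4 : ℝ) 1)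
    (g := fun j c => ⌊c * (b : ℝ) ^ (j + 2) ^ 2⌋₊) (K := fun j => (j + 2) ^ 2) zero_le_one
    (fun j => by gcongr; omega) (fun j c hc => floor_mul_mem hb hc j)
    (fun j n _ => volume_floor_fiber_le (fun c hc => by linarith [hc.1]) (by linarith [hR j]) n)
  have h2 := ae_isUnbiasedSeq hb (I := Set.Ioo (3 / 4 : ℝ) 1)
    (g := fun j c => ⌈(b : ℝ) ^ (j + 2) ^ 2 / c⌉₊) (K := fun j => (j + 2) ^ 2 + 1)
    (M := 2 * b) (by positivity)
    (fun j => by linarith [Nat.pow_le_pow_left (show j + 1 ≤ j + 2 by omega) 2])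
    (fun j c hc => ceil_div_mem hb hc le_rfl (by linarith [hR j]))
    (fun j n hn => by
      refine (volume_ceil_div_fiber_le (fun c hc => by linarith [hc.1]) (by linarith [hR j])
        (by exact_mod_cast hn)).trans (le_of_eq ?_)
      rw [pow_succ (b : ℝ) ((j + 2) ^ 2)]
      congr 1
      field_simp)
  refine exists_mem_Ioo_of_ae (by norm_num) ?_
  filter_upwards [h1, h2] with c hc1 hc2 hc
  exact ⟨hc1 hc, hc2 hc⟩

lemma exists_numerator (hb : 2 ≤ b) {c : ℝ} (hc : c ∈ Set.Ioo (3 / 4 : ℝ) 1) :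
    ∃ y ∈ Set.Ioo (1 : ℝ) (5 / 4),
      (IsUnbiasedSeq fun j : ℕ => digitsFin b (two_pos.trans_le hb) ⌊y * (b : ℝ) ^ (j + 2) ^ 2⌋₊) ∧
      IsUnbiasedSeq fun j : ℕ =>
        digitsFin b (two_pos.trans_le hb) ⌈(⌊y * (b : ℝ) ^ (j + 2) ^ 2⌋₊ : ℝ) / c⌉₊ := by
  have hb0 : (b : ℝ) ≠ 0 := by exact_mod_cast (show b ≠ 0 by omega)
  have hb1 : (1 : ℝ) ≤ b := by exact_mod_cast (show 1 ≤ b by omega)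
  have hR : ∀ j : ℕ, (16 : ℝ) ≤ (b : ℝ) ^ (j + 2) ^ 2 := fun j => by
    exact_mod_cast sixteen_le_pow hb j
  have hM : ∀ j : ℕ, 2 * b / (b : ℝ) ^ ((j + 2) ^ 2 + 1) = 2 / (b : ℝ) ^ (j + 2) ^ 2 := fun j => by
    rw [pow_succ (b : ℝ) ((j + 2) ^ 2)]
    field_simp
  have h1 := ae_isUnbiasedSeq hb (I := Set.Ioo (1 : ℝ) (5 / 4))
    (g := fun j y => ⌊y * (b : ℝ) ^ (j + 2) ^ 2⌋₊) (K := fun j => (j + 2) ^ 2 + 1)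
    (M := 2 * b) (by positivity)
    (fun j => by linarith [Nat.pow_le_pow_left (show j + 1 ≤ j + 2 by omega) 2])
    (fun j y hy => natFloor_mul_mem hb hy j)
    (fun j n _ => by
      refine (volume_floor_fiber_le (fun y hy => by linarith [hy.1])
        (by linarith [hR j]) n).trans ?_
      rw [hM]
      gcongr
      norm_num)
  have h2 := ae_isUnbiasedSeq hb (I := Set.Ioo (1 : ℝ) (5 / 4))
    (g := fun j y => ⌈(⌊y * (b : ℝ) ^ (j + 2) ^ 2⌋₊ : ℝ) / c⌉₊) (K := fun j => (j + 2) ^ 2 + 1)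
    (M := 2 * b) (by positivity)
    (fun j => by linarith [Nat.pow_le_pow_left (show j + 1 ≤ j + 2 by omega) 2])
    (fun j y hy => ceil_div_mem hb hc (cast_floor_mul_mem hb hy j).1 (cast_floor_mul_mem hb hy j).2)
    (fun j n _ => by
      rw [hM]
      exact volume_ceil_floor_fiber_le (fun y hy => by linarith [hy.1]) (by linarith [hc.1])
        hc.2.le (by linarith [hR j]) n)
  refine exists_mem_Ioo_of_ae (by norm_num) ?_
  filter_upwards [h1, h2] with y hy1 hy2 hy
  exact ⟨hy1 hy, hy2 hy⟩

end Rounding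

section Interleaving

variable {b : ℕ}

lemma abs_slideN_sub_le_of_isUnbiasedSeq {α : Type*} [Fintype α] [DecidableEq α] [Nonempty α]
    {x : ℕ → List α} (hx : IsUnbiasedSeq x)
    (hlen : ∀ j, |((x j).length : ℝ) - lengthWeight j| ≤ 1) (w : List α) {ε : ℝ} (hε : 0 < ε) :
    ∀ᶠ j in Filter.atTop,
      |(slideN w (x j) : ℝ) - lengthWeight j * ((Fintype.card α : ℝ)⁻¹) ^ w.length| ≤
        ε * lengthWeight j := by
  set q := ((Fintype.card α : ℝ)⁻¹) ^ w.length with hq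
  have hq0 : 0 ≤ q := by positivity
  have hq1 : q ≤ 1 := by
    refine pow_le_one₀ (by positivity) (inv_le_one_of_one_le₀ ?_)
    exact_mod_cast Fintype.card_pos
  filter_upwards [hx w (ε / 4) (by positivity),
    (Asymptotics.isLittleO_iff.1 one_isLittleO_lengthWeight) (show 0 < min 1 (ε / 4) by positivity)]
    with j hj hone
  rw [Real.norm_of_nonneg zero_le_one, Real.norm_of_nonneg (lengthWeight_pos j).le] at hone
  have hone1 : 1 ≤ lengthWeight j := hone.trans
    (mul_le_of_le_one_left (lengthWeight_pos j).le (min_le_left _ _))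
  have hone2 : 1 ≤ ε / 4 * lengthWeight j := hone.trans
    (mul_le_mul_of_nonneg_right (min_le_right _ _) (lengthWeight_pos j).le)
  rw [IsBiased, not_lt, ← hq] at hj
  have h1 : |((x j).length : ℝ) * q - lengthWeight j * q| ≤ 1 := by
    rw [← sub_mul, abs_mul, abs_of_nonneg hq0]
    exact (mul_le_of_le_one_right (abs_nonneg _) hq1).trans (hlen j)
  have h2 := abs_sub_le (slideN w (x j) : ℝ) ((x j).length * q) (lengthWeight j * q)
  have h3 := (abs_le.1 (hlen j)).2
  have h4 : ε / 4 * ((x j).length : ℝ) ≤ ε / 4 * (2 * lengthWeight j) :=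
    mul_le_mul_of_nonneg_left (by linarith) (by positivity)
  linarith

lemma abs_slideN_cons_replicate_sub_le {α : Type*} [DecidableEq α] {w : List α} (hw : w ≠ [])
    (d z : α) (k : ℕ) :
    |(slideN w (d :: List.replicate k z) : ℝ) -
      k * (if w = List.replicate w.length z then 1 else 0)| ≤ w.length + 1 := by
  have h1 := slideN_replicate_le hw z k
  have h2 := le_slideN_replicate (w := w) z k
  have h3 := slideN_cons hw d (List.replicate k z)
  have h4 : (if w <+: d :: List.replicate k z then 1 else 0) ≤ 1 := by split_ifs <;> omega
  have h5 : ((k : ℝ) * (if w = List.replicate w.length z then 1 else 0)) =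
      ((if w = List.replicate w.length z then k else 0 : ℕ) : ℝ) := by
    split_ifs <;> simp
  rw [h5, abs_le]
  have h6 : slideN w (d :: List.replicate k z) ≤
      (if w = List.replicate w.length z then k else 0) + 1 := by omega
  have h7 : (if w = List.replicate w.length z then k else 0) ≤
      slideN w (d :: List.replicate k z) + w.length := by omega
  have h6' : (slideN w (d :: List.replicate k z) : ℝ) ≤
      ((if w = List.replicate w.length z then k else 0 : ℕ) : ℝ) + 1 := by exact_mod_cast h6
  have h7' : ((if w = List.replicate w.length z then k else 0 : ℕ) : ℝ) ≤
      (slideN w (d :: List.replicate k z) : ℝ) + w.length := by exact_mod_cast h7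
  have h8 : (0 : ℝ) ≤ w.length := Nat.cast_nonneg _
  constructor <;> linarith

open scoped Classical in
theorem dimFS_concatSeq_of_unbiased (hb : 2 ≤ b) (L x y : ℕ → List (Fin b)) (X : Set ℕ) (s : ℝ)
    (hx : IsUnbiasedSeq x) (hy : IsUnbiasedSeq y)
    (hlenx : ∀ j, |((x j).length : ℝ) - lengthWeight j| ≤ 1)
    (hleny : ∀ j, |((y j).length : ℝ) - lengthWeight j| ≤ 1)
    (hX : ∀ j ∈ X, L j = digitsFin b (two_pos.trans_le hb) (b ^ (j + 2) ^ 2))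
    (hX' : ∀ j ∉ X, L j = x j ∨ L j = y j)
    (hlow : ∀ ε : ℝ, 0 < ε → ∀ᶠ m in Filter.atTop, s - ε ≤
      (∑ i ∈ Finset.range m, lengthWeight i * (if i ∈ X then 0 else 1)) /
        ∑ i ∈ Finset.range m, lengthWeight i)
    (hup : ∀ ε : ℝ, 0 < ε → ∃ᶠ m in Filter.atTop,
      (∑ i ∈ Finset.range m, lengthWeight i * (if i ∈ X then 0 else 1)) /
        ∑ i ∈ Finset.range m, lengthWeight i ≤ s + ε) :
    dimFS (concatSeq ⟨0, two_pos.trans_le hb⟩ L) = s := by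
  have : Nonempty (Fin b) := ⟨⟨0, two_pos.trans_le hb⟩⟩
  have hlenL : ∀ j, |((L j).length : ℝ) - lengthWeight j| ≤ 1 := by
    intro j
    by_cases hj : j ∈ X
    · rw [hX j hj, digitsFin_pow hb, List.length_cons, List.length_replicate, lengthWeight]
      push_cast
      simp
    · rcases hX' j hj with h | h <;> rw [h]
      exacts [hlenx j, hleny j]
  have hone := Asymptotics.isLittleO_iff.1 one_isLittleO_lengthWeight
  refine dimFS_concatSeq (by simpa using hb) _ L lengthWeight (fun i => if i ∈ X then 0 else 1) s
    (fun j hj => ?_) lengthWeight_pos one_isLittleO_lengthWeight lengthWeight_isLittleO_sum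
    (fun i => by split_ifs <;> simp) ?_ (fun w hw => ?_) hlow hup
  · have h := (abs_le.1 (hlenL j)).1
    rw [hj, List.length_nil, Nat.cast_zero, lengthWeight] at h
    nlinarith [Nat.cast_nonneg (α := ℝ) j]
  · rw [Asymptotics.isLittleO_iff]
    intro ε hε
    filter_upwards [hone hε] with j hj
    exact (hlenL j).trans (by simpa using hj)
  · rw [Asymptotics.isLittleO_iff]
    intro ε hε
    filter_upwards [abs_slideN_sub_le_of_isUnbiasedSeq hx hlenx w hε,
      abs_slideN_sub_le_of_isUnbiasedSeq hy hleny w hε,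
      hone (show 0 < ε / (w.length + 1) by positivity)] with j hjx hjy hj
    rw [Real.norm_of_nonneg zero_le_one, Real.norm_of_nonneg (lengthWeight_pos j).le,
      div_mul_eq_mul_div, le_div_iff₀ (by positivity), one_mul] at hj
    rw [Real.norm_eq_abs, Real.norm_of_nonneg (lengthWeight_pos j).le, mixWeight]
    by_cases hjX : j ∈ X
    · rw [if_pos hjX, hX j hjX, digitsFin_pow hb, zero_mul, zero_add, sub_zero, one_mul]
      refine le_trans ?_ hj
      have h := abs_slideN_cons_replicate_sub_le hw (⟨1, by omega⟩ : Fin b) ⟨0, two_pos.trans_le hb⟩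
        ((j + 2) ^ 2)
      push_cast at h
      exact h
    · rw [if_neg hjX, one_mul, sub_self, zero_mul, add_zero]
      rcases hX' j hjX with h | h <;> rw [h]
      exacts [hjx, hjy]

end Interleaving

/-- For every base `b ≥ 2` and every `s, s′ ∈ [0,1]` there exist an
infinite set `A ⊆ ℕ` and a real `c > 0` (giving the linear polynomial `p(x) = cx`)
with `dim_FS(CE_b(A)) = s` and `dim_FS(CE_b(p(A))) = s′`, where `CE_b(p(A))` is the
concatenation of the base-`b` expansions of the integer parts `⌊c·n⌋` for `n ∈ A` in
increasing order of `n`. -/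
theorem stmt7 (b : ℕ) (hb : 2 ≤ b) (s s' : ℝ)
    (hs : s ∈ Set.Icc (0 : ℝ) 1) (hs' : s' ∈ Set.Icc (0 : ℝ) 1) :
    ∃ (A : Set ℕ) (c : ℝ), A.Infinite ∧ 0 < c ∧
      dimFS (CEseq b (by omega) A) = s ∧
      dimFS (CEseqF b (by omega) A (fun n => c * n)) = s' := by
  classical
  have hb1 : 1 < b := hb
  have hb0 : 0 < b := by omega
  obtain ⟨X, Y, hXY, ⟨hlow, hup⟩, hlow', hup'⟩ := exists_disjoint_limsup_density lengthWeight_pos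
    lengthWeight_mono lengthWeight_isLittleO_sum hs hs'
  obtain ⟨c, hc, hfloor, hceil⟩ := exists_slope hb
  obtain ⟨y, hy, hnum, hquot⟩ := exists_numerator hb hc
  have hc0 : 0 < c := by linarith [hc.1]
  set R : ℕ → ℝ := fun j => (b : ℝ) ^ (j + 2) ^ 2 with hR
  have hR16 : ∀ j, 16 ≤ R j := fun j => by
    simp only [hR]
    exact_mod_cast sixteen_le_pow hb j
  have hceil_mem := fun j => ceil_div_mem (x := R j) hb hc le_rfl (by linarith [hR16 j])
  have hquot_mem := fun j => ceil_div_mem hb hc (cast_floor_mul_mem hb hy j).1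
    (cast_floor_mul_mem hb hy j).2
  set n : ℕ → ℕ := fun j => if j ∈ X then b ^ (j + 2) ^ 2 else
    if j ∈ Y then ⌈R j / c⌉₊ else ⌈(⌊y * R j⌋₊ : ℝ) / c⌉₊ with hn
  have hn_mem : ∀ j, b ^ (j + 2) ^ 2 ≤ n j ∧ n j < b ^ ((j + 2) ^ 2 + 1) := by
    intro j
    simp only [hn]
    split_ifs
    · exact ⟨le_rfl, Nat.pow_lt_pow_right hb1 (Nat.lt_succ_self _)⟩
    · exact hceil_mem j
    · exact hquot_mem j
  have hmono : StrictMono n := strictMono_nat_of_lt_succ fun j =>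
    (hn_mem j).2.trans_le ((Nat.pow_le_pow_right hb0 (by ring_nf; omega)).trans (hn_mem (j + 1)).1)
  have hinf : (Set.range n).Infinite := Set.infinite_range_of_injective hmono.injective
  have hnth : Nat.nth (· ∈ Set.range n) = n :=
    ((Nat.nth_strictMono hinf).range_inj hmono).1 (Nat.range_nth_of_infinite hinf)
  have hround : ∀ m : ℕ, ⌊c * (⌈(m : ℝ) / c⌉₊ : ℝ)⌋₊ = m := by
    intro m
    have h1 := Nat.le_ceil ((m : ℝ) / c)
    have h2 := Nat.ceil_lt_add_one (show 0 ≤ (m : ℝ) / c by positivity)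
    rw [div_le_iff₀ hc0] at h1
    rw [← sub_lt_iff_lt_add, lt_div_iff₀ hc0] at h2
    rw [Nat.floor_eq_iff (by positivity)]
    constructor <;> nlinarith [hc.2]
  have hlen : ∀ {g : ℕ → ℕ}, (∀ j, b ^ (j + 2) ^ 2 ≤ g j ∧ g j < b ^ ((j + 2) ^ 2 + 1)) →
      ∀ j, |((digitsFin b hb0 (g j)).length : ℝ) - lengthWeight j| ≤ 1 := by
    intro g hg j
    rw [digitsFin_length_of_mem hb (hg j).1 (hg j).2, lengthWeight]
    push_cast
    simp
  have hlen_floor : ∀ j, |((digitsFin b hb0 ⌊c * R j⌋₊).length : ℝ) - lengthWeight j| ≤ 1 := by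
    intro j
    have hpos : 1 ≤ (j + 2) ^ 2 := Nat.one_le_pow _ _ (by omega)
    have h := floor_mul_mem hb hc j
    rw [digitsFin_length_of_mem hb h.1 (by rw [Nat.sub_add_cancel hpos]; exact h.2),
      Nat.sub_add_cancel hpos, lengthWeight]
    push_cast
    simp
  refine ⟨Set.range n, c, hinf, hc0, ?_, ?_⟩
  · rw [CEseq, hnth]
    refine dimFS_concatSeq_of_unbiased hb _ _ _ X s hceil hquot (hlen hceil_mem) (hlen hquot_mem)
      (fun j hj => ?_) (fun j hj => ?_) hlow hup
    · simp only [hn, if_pos hj]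
    · simp only [hn, if_neg hj]
      split_ifs
      exacts [Or.inl rfl, Or.inr rfl]
  · rw [CEseqF, hnth]
    refine dimFS_concatSeq_of_unbiased hb _ _ _ Y s' hfloor hnum hlen_floor
      (hlen fun j => natFloor_mul_mem hb hy j) (fun j hj => ?_) (fun j hj => ?_) hlow' hup'
    · have hjX : j ∉ X := fun h => Set.disjoint_left.1 hXY h hj
      have h := hround (b ^ (j + 2) ^ 2)
      push_cast at h
      simp only [hn, if_neg hjX, if_pos hj, hR, h]
    · by_cases hjX : j ∈ X
      · left
        simp only [hn, if_pos hjX, hR]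
        push_cast
        rfl
      · right
        simp only [hn, if_neg hjX, if_neg hj, hround]
        rfl
end

section
/- Let b ≥ 2, let S ∈ Σ_b^∞ be Borel normal in base b, and let S⁰ be a sequence obtained from S by inserting strings of zeros (elements of {0}^*) such that the number of inserted strings occurring among the first n positions has upper asymptotic density zero as n → ∞. Let z(n) denote the number of inserted zeros occurring in the length-n prefix of S⁰. Then dim_FS(S⁰) = 1 − limsup_{n→∞} z(n)/n and Dim_FS(S⁰) = 1 − liminf_{n→∞} z(n)/n. -/
/-- Upper asymptotic density of a set of natural numbers:
`limsup_{n→∞} |I ∩ [0,n)| / n`. -/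
noncomputable def upperDensity (I : Set ℕ) : ℝ :=
  Filter.limsup (fun n => ((I ∩ Set.Iio n).ncard : ℝ) / n) Filter.atTop
/-- A sequence `S ∈ Σ_b^∞` is Borel normal in base `b` if every nonempty string
`w` occurs with limiting sliding-block frequency `b^{-|w|}`. -/
def BorelNormal {b : ℕ} (S : ℕ → Fin b) : Prop :=
  ∀ w : List (Fin b), w ≠ [] →
    Filter.Tendsto (fun n => (slideN w (pre S n) : ℝ) / (n : ℝ)) Filter.atTop
      (nhds (((b : ℝ) ^ w.length)⁻¹))

open Filter Topology Finset

/-- Number of `i < K` such that `v` occurs in `S` at position `i`. -/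
def occCount {α : Type*} [DecidableEq α] (S : ℕ → α) {l : ℕ} (v : Fin l → α) (K : ℕ) : ℕ :=
  #{i ∈ range K | ∀ j : Fin l, S (i + j) = v j}

theorem pre_length {α : Type*} (S : ℕ → α) (n : ℕ) : (pre S n).length = n + 1 := by
  simp [pre]

theorem slideN_ofFn_pre {α : Type*} [DecidableEq α] (S : ℕ → α) {l : ℕ} (v : Fin l → α)
    (n : ℕ) : slideN (List.ofFn v) (pre S n) = occCount S v (n + 2 - l) := by
  unfold slideN occCount
  rw [pre_length, List.length_ofFn]
  congr 1
  refine Finset.filter_congr fun i hi => ?_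
  rw [Finset.mem_range] at hi
  constructor
  · intro h j
    have h1 := congrArg (fun L => L[(j : ℕ)]?) h
    have hj := j.2
    have h3 : i + (j : ℕ) < n + 1 := by omega
    simpa [pre, List.getElem?_take, List.getElem?_drop, List.getElem?_ofFn, h3, hj,
      -List.ofFn_succ] using h1
  · intro h
    apply List.ext_getElem?
    intro j
    by_cases hj : j < l
    · have h3 : i + j < n + 1 := by omega
      simpa [pre, List.getElem?_take, List.getElem?_drop, List.getElem?_ofFn, h3, hj,
        -List.ofFn_succ] using h ⟨j, hj⟩
    · simp [hj]

theorem occCount_le {α : Type*} [DecidableEq α] (S : ℕ → α) {l : ℕ} (v : Fin l → α) (K : ℕ) :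
    occCount S v K ≤ K :=
  (Finset.card_filter_le _ _).trans (by simp)

/-- Block entropy computed from the counts `occCount`. -/
noncomputable def occEntropy {α : Type*} [Fintype α] [DecidableEq α] (S : ℕ → α) (l K : ℕ) : ℝ :=
  (∑ v : Fin l → α, Real.negMulLog (occCount S v K / K)) / (l * Real.log (Fintype.card α))

theorem slideH_pre {α : Type*} [Fintype α] [DecidableEq α] (S : ℕ → α) (l k : ℕ) :
    slideH l (pre S (k + l)) = occEntropy S l (k + 2) := by
  unfold slideH occEntropy
  rw [Finset.mul_sum, Finset.sum_div]
  refine Finset.sum_congr rfl fun v _ => ?_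
  have h : slideP (List.ofFn v) (pre S (k + l)) = occCount S v (k + 2) / ((k + 2 : ℕ) : ℝ) := by
    unfold slideP
    rw [slideN_ofFn_pre, pre_length, List.length_ofFn, show k + l + 2 - l = k + 2 by omega]
    congr 1
    push_cast
    ring
  rw [h, Real.logb, Real.log_inv, Real.negMulLog, div_eq_mul_inv _ ((l : ℝ) * _), mul_inv]
  ring

theorem liminf_slideH {α : Type*} [Fintype α] [DecidableEq α] (S : ℕ → α) (l : ℕ) :
    liminf (fun n => slideH l (pre S n)) atTop = liminf (occEntropy S l) atTop := by
  rw [← liminf_nat_add (fun n => slideH l (pre S n)) l, ← liminf_nat_add (occEntropy S l) 2]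
  simp only [slideH_pre]

theorem limsup_slideH {α : Type*} [Fintype α] [DecidableEq α] (S : ℕ → α) (l : ℕ) :
    limsup (fun n => slideH l (pre S n)) atTop = limsup (occEntropy S l) atTop := by
  rw [← limsup_nat_add (fun n => slideH l (pre S n)) l, ← limsup_nat_add (occEntropy S l) 2]
  simp only [slideH_pre]

theorem BorelNormal.tendsto_occCount {b : ℕ} {S : ℕ → Fin b} (hS : BorelNormal S) {l : ℕ}
    (hl : l ≠ 0) (v : Fin l → Fin b) :
    Tendsto (fun K : ℕ => (occCount S v K / K : ℝ)) atTop (𝓝 ((b : ℝ) ^ l)⁻¹) := by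
  have h := hS (List.ofFn v) (by simpa using hl)
  rw [List.length_ofFn] at h
  rw [← tendsto_add_atTop_iff_nat l] at h
  rw [← tendsto_add_atTop_iff_nat 2]
  have h2 : Tendsto (fun k : ℕ => ((k + l : ℕ) : ℝ) / ((k + 2 : ℕ) : ℝ)) atTop (𝓝 1) := by
    have h3 : Tendsto (fun k : ℕ => 1 + ((l : ℝ) - 2) / ((k + 2 : ℕ) : ℝ)) atTop (𝓝 (1 + 0)) :=
      ((tendsto_const_div_atTop_nhds_zero_nat _).comp (tendsto_add_atTop_nat 2)).const_add 1
    rw [add_zero] at h3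
    refine h3.congr fun k => ?_
    have : ((k + 2 : ℕ) : ℝ) ≠ 0 := by positivity
    field_simp
    push_cast
    ring
  have h4 := h.mul h2
  rw [mul_one] at h4
  refine h4.congr' ?_
  filter_upwards [eventually_gt_atTop 0] with k hk
  rw [slideN_ofFn_pre, show k + l + 2 - l = k + 2 by omega]
  have : ((k + l : ℕ) : ℝ) ≠ 0 := by positivity
  field_simp

theorem StrictMono.exists_lt_iff_lt {g : ℕ → ℕ} (hg : StrictMono g) :
    ∃ m : ℕ → ℕ, ∀ K k, g k < K ↔ k < m K := by
  classical
  have h : ∀ K, ∃ k, K ≤ g k := fun K => ⟨K, hg.id_le K⟩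
  refine ⟨fun K => Nat.find (h K), fun K k => ⟨fun hk => ?_, fun hk => ?_⟩⟩
  · by_contra! hle
    have := hg.monotone hle
    have := Nat.find_spec (h K)
    omega
  · simpa using Nat.find_min (h K) hk

theorem card_filter_image_strictMono {g : ℕ → ℕ} (hg : StrictMono g) {m : ℕ → ℕ}
    (hm : ∀ K k, g k < K ↔ k < m K) (p : ℕ → Prop) [DecidablePred p]
    [DecidablePred fun i => ∃ k, g k = i ∧ p k] (K : ℕ) :
    #{i ∈ range K | ∃ k, g k = i ∧ p k} = #{k ∈ range (m K) | p k} := by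
  rw [← Finset.card_image_of_injective {k ∈ range (m K) | p k} hg.injective]
  congr 1
  ext i
  simp only [mem_filter, mem_range, mem_image]
  constructor
  · rintro ⟨hi, k, rfl, hk⟩
    exact ⟨k, ⟨(hm K k).1 hi, hk⟩, rfl⟩
  · rintro ⟨k, ⟨h1, h2⟩, rfl⟩
    exact ⟨(hm K k).2 h1, k, rfl, h2⟩

/-- A strictly monotone enumeration advances by one along a window contained in its range. -/
theorem StrictMono.apply_add_of_mem_range {g : ℕ → ℕ} (hg : StrictMono g) {k l : ℕ}
    (h : ∀ j < l, g k + j ∈ Set.range g) : ∀ j < l, g (k + j) = g k + j := by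
  intro j
  induction j with
  | zero => simp
  | succ j ih =>
    intro hj
    have ih := ih (by omega)
    obtain ⟨k', hk'⟩ := h (j + 1) hj
    have h1 : k + j < k' := hg.lt_iff_lt.1 (by omega)
    have h2 : g (k + (j + 1)) ≤ g k' := hg.monotone (by omega)
    have h3 : g (k + j) < g (k + (j + 1)) := hg (by omega)
    omega

open scoped Classical in
theorem card_changes_le (J : Set ℕ) (K : ℕ) :
    #{i ∈ range K | ¬ (i ∈ J ↔ i + 1 ∈ J)} + (if K ∈ J then 1 else 0) ≤
      2 * #{j ∈ range (K + 1) | j ∈ J ∧ (j = 0 ∨ j - 1 ∉ J)} := by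
  induction K with
  | zero => by_cases h : 0 ∈ J <;> simp [h, Finset.filter_singleton]
  | succ K ih =>
    rw [Finset.range_add_one (n := K), Finset.range_add_one (n := K + 1), Finset.filter_insert,
      Finset.filter_insert]
    by_cases h1 : K ∈ J <;> by_cases h2 : K + 1 ∈ J <;> simp [h1, h2] at ih ⊢ <;> omega

open scoped Classical in
theorem card_mixed_windows_le (J : Set ℕ) (l K : ℕ) :
    #{i ∈ range K | ¬ ∀ j < l, (i + j ∈ J ↔ i ∈ J)} ≤
      l * (2 * #{j ∈ range (K + l + 1) | j ∈ J ∧ (j = 0 ∨ j - 1 ∉ J)}) := by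
  have hsub : {i ∈ range K | ¬ ∀ j < l, (i + j ∈ J ↔ i ∈ J)} ⊆
      (range l).biUnion fun t => {i ∈ range K | ¬ (i + t ∈ J ↔ i + t + 1 ∈ J)} := by
    intro i hi
    simp only [mem_filter, mem_biUnion, mem_range] at hi ⊢
    by_contra! hcon
    refine hi.2 fun j => ?_
    induction j with
    | zero => simp
    | succ j ih =>
      intro hj
      rw [← ih (by omega)]
      exact (hcon j (by omega) hi.1).symm
  refine (Finset.card_le_card hsub).trans ?_
  refine (Finset.card_biUnion_le_card_mul _ _ _ fun t ht => ?_).trans_eq (by rw [card_range])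
  rw [mem_range] at ht
  refine le_trans ?_ ((Nat.le_add_right _ _).trans (card_changes_le J (K + l)))
  refine Finset.card_le_card_of_injOn (fun i => i + t) (fun i hi => ?_)
    (fun _ _ _ _ h => Nat.add_right_cancel h)
  simp only [coe_filter, mem_range, Set.mem_ofPred_eq] at hi ⊢
  exact ⟨by omega, hi.2⟩

theorem ncard_inter_Iio (J : Set ℕ) [DecidablePred (· ∈ J)] (K : ℕ) :
    (J ∩ Set.Iio K).ncard = #{i ∈ range K | i ∈ J} := by
  rw [← Set.ncard_coe_finset]
  congr 1
  ext i
  simp [and_comm]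

/-- Up to windows meeting both kinds of positions, the occurrences of `v` in `T` are those in `S`
together with the inserted positions in case `v` is constantly the inserted symbol. -/
theorem abs_occCount_sub_le {α : Type*} [DecidableEq α] {S T : ℕ → α} {J : Set ℕ} {a : α}
    {g : ℕ → ℕ} (hg : StrictMono g) (hrange : Set.range g = Jᶜ) (hmatch : ∀ n, T (g n) = S n)
    (hzero : ∀ j ∈ J, T j = a) {m : ℕ → ℕ} (hm : ∀ K k, g k < K ↔ k < m K) {l : ℕ}
    (v : Fin l → α) (K : ℕ) :
    |(occCount T v K : ℝ) - (occCount S v (m K) +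
        if v = fun _ => a then ((J ∩ Set.Iio K).ncard : ℝ) else 0)| ≤
      l * (2 * ({j | j ∈ J ∧ (j = 0 ∨ j - 1 ∉ J)} ∩ Set.Iio (K + l + 1)).ncard) := by
  classical
  have hnot : ∀ k, g k ∉ J := fun k => by
    have : g k ∈ Jᶜ := hrange ▸ Set.mem_range_self k
    exact this
  have hmix := card_mixed_windows_le J l K
  set B := {i ∈ range K | ¬ ∀ j < l, (i + j ∈ J ↔ i ∈ J)} with hB
  set O := {i ∈ range K | ∀ j : Fin l, T (i + j) = v j} with hO
  set M₁ := {i ∈ range K | ∃ k, g k = i ∧ ∀ j : Fin l, S (k + j) = v j} with hM₁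
  set M₂ := {i ∈ range K | i ∈ J ∧ v = fun _ => a} with hM₂
  have hcard₁ : #M₁ = occCount S v (m K) := card_filter_image_strictMono hg hm _ K
  have hcard₂ : #M₂ = if v = fun _ => a then (J ∩ Set.Iio K).ncard else 0 := by
    split_ifs with h
    · rw [ncard_inter_Iio]; simp [hM₂, h]
    · simp [hM₂, h]
  have hdisj : Disjoint M₁ M₂ := by
    rw [Finset.disjoint_left]
    intro i h1 h2
    simp only [hM₁, hM₂, mem_filter] at h1 h2
    obtain ⟨-, k, rfl, -⟩ := h1
    exact hnot k h2.2.1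
  have hmem : ∀ i ∈ range K, i ∉ B → (i ∈ O ↔ i ∈ M₁ ∪ M₂) := by
    intro i hi hiB
    simp only [hB, hO, hM₁, hM₂, mem_union, mem_filter, hi, true_and, not_not] at hiB ⊢
    by_cases hiJ : i ∈ J
    · have h1 : ¬ ∃ k, g k = i ∧ ∀ j : Fin l, S (k + j) = v j := by
        rintro ⟨k, rfl, -⟩
        exact hnot k hiJ
      have h2 : ∀ j : Fin l, T (i + j) = a := fun j => hzero _ ((hiB j j.2).2 hiJ)
      simp only [h1, hiJ, h2, true_and, false_or, funext_iff]
      exact forall_congr' fun j => eq_comm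
    · obtain ⟨k, rfl⟩ : i ∈ Set.range g := hrange ▸ hiJ
      have h1 := hg.apply_add_of_mem_range (k := k) (l := l) fun j hj => by
        rw [hrange]
        exact fun h => hiJ ((hiB j hj).1 h)
      have h2 : ∀ j : Fin l, T (g k + j) = S (k + j) := fun j => by
        rw [← h1 j j.2, hmatch]
      simp only [hiJ, h2, false_and, or_false]
      constructor
      · exact fun h => ⟨k, rfl, h⟩
      · rintro ⟨k', hk', h⟩
        rwa [hg.injective hk'] at h
  have hle₁ : #O ≤ #M₁ + #M₂ + #B := by
    rw [← Finset.card_union_of_disjoint hdisj]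
    refine (Finset.card_le_card fun i hi => ?_).trans (Finset.card_union_le _ _)
    by_cases hiB : i ∈ B
    · exact mem_union_right _ hiB
    · exact mem_union_left _ ((hmem i (mem_filter.1 hi).1 hiB).1 hi)
  have hle₂ : #M₁ + #M₂ ≤ #O + #B := by
    rw [← Finset.card_union_of_disjoint hdisj]
    refine (Finset.card_le_card fun i hi => ?_).trans (Finset.card_union_le _ _)
    by_cases hiB : i ∈ B
    · exact mem_union_right _ hiB
    · refine mem_union_left _ ((hmem i ?_ hiB).2 hi)
      rcases mem_union.1 hi with h | h <;> exact (mem_filter.1 h).1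
  have hI : ({j | j ∈ J ∧ (j = 0 ∨ j - 1 ∉ J)} ∩ Set.Iio (K + l + 1)).ncard =
      #{j ∈ range (K + l + 1) | j ∈ J ∧ (j = 0 ∨ j - 1 ∉ J)} := by
    rw [ncard_inter_Iio]; rfl
  rw [hI]
  have hO' : occCount T v K = #O := rfl
  rw [hO', ← hcard₁]
  have hcast : (if v = fun _ => a then ((J ∩ Set.Iio K).ncard : ℝ) else 0) = #M₂ := by
    rw [hcard₂]; split_ifs <;> simp
  rw [hcast]
  have hmix' : (#B : ℝ) ≤ l * (2 * #{j ∈ range (K + l + 1) | j ∈ J ∧ (j = 0 ∨ j - 1 ∉ J)}) := by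
    exact_mod_cast hmix
  refine le_trans ?_ hmix'
  have h1 : (#O : ℝ) ≤ #M₁ + #M₂ + #B := by exact_mod_cast hle₁
  have h2 : (#M₁ + #M₂ : ℝ) ≤ #O + #B := by exact_mod_cast hle₂
  rw [abs_le]
  constructor <;> linarith

theorem ncard_inter_Iio_le (I : Set ℕ) (n : ℕ) : (I ∩ Set.Iio n).ncard ≤ n := by
  classical
  rw [ncard_inter_Iio]
  exact (Finset.card_filter_le _ _).trans (by simp)

theorem ncard_inter_Iio_div_mem_Icc (I : Set ℕ) (n : ℕ) :
    ((I ∩ Set.Iio n).ncard : ℝ) / n ∈ Set.Icc (0 : ℝ) 1 :=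
  ⟨by positivity, div_le_one_of_le₀ (by exact_mod_cast ncard_inter_Iio_le I n) (by positivity)⟩

theorem tendsto_of_upperDensity_eq_zero {I : Set ℕ} (hI : upperDensity I = 0) :
    Tendsto (fun n : ℕ => ((I ∩ Set.Iio n).ncard : ℝ) / n) atTop (𝓝 0) := by
  have hbdd : IsBoundedUnder (· ≤ ·) atTop fun n : ℕ => ((I ∩ Set.Iio n).ncard : ℝ) / n :=
    isBoundedUnder_of ⟨1, fun n => (ncard_inter_Iio_div_mem_Icc I n).2⟩
  have hbdd' : IsBoundedUnder (· ≥ ·) atTop fun n : ℕ => ((I ∩ Set.Iio n).ncard : ℝ) / n :=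
    isBoundedUnder_of ⟨0, fun n => (ncard_inter_Iio_div_mem_Icc I n).1⟩
  refine tendsto_of_le_liminf_of_limsup_le ?_ hI.le hbdd hbdd'
  exact le_liminf_of_le hbdd.isCoboundedUnder_ge
    (Eventually.of_forall fun n => (ncard_inter_Iio_div_mem_Icc I n).1)

/-- The limiting frequencies of words in the diluted sequence. -/
theorem tendsto_occCount_sub {b : ℕ} {S T : ℕ → Fin b} {J : Set ℕ} {a : Fin b}
    (hS : BorelNormal S) {g : ℕ → ℕ} (hg : StrictMono g) (hrange : Set.range g = Jᶜ)
    (hmatch : ∀ n, T (g n) = S n) (hzero : ∀ j ∈ J, T j = a)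
    (hblocks : upperDensity {j | j ∈ J ∧ (j = 0 ∨ j - 1 ∉ J)} = 0) {l : ℕ} (hl : l ≠ 0)
    (v : Fin l → Fin b) :
    Tendsto (fun K : ℕ => (occCount T v K / K : ℝ) -
      ((1 - ((J ∩ Set.Iio K).ncard : ℝ) / K) * ((b : ℝ) ^ l)⁻¹ +
        ((J ∩ Set.Iio K).ncard : ℝ) / K * if v = fun _ => a then 1 else 0)) atTop (𝓝 0) := by
  classical
  obtain ⟨m, hm⟩ := hg.exists_lt_iff_lt
  have hmtop : Tendsto m atTop atTop := by
    refine tendsto_atTop.2 fun k => ?_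
    filter_upwards [eventually_gt_atTop (g k)] with K hK
    exact ((hm K k).1 hK).le
  have hmK : ∀ K, (m K : ℝ) = K - ((J ∩ Set.Iio K).ncard : ℝ) := by
    intro K
    have h1 := card_filter_image_strictMono hg hm (fun _ => True) K
    simp only [and_true, filter_true, card_range] at h1
    have h2 := Finset.card_filter_add_card_filter_not (s := range K) (fun i => i ∈ J)
    have h3 : {i ∈ range K | ∃ k, g k = i} = {i ∈ range K | ¬ i ∈ J} := by
      refine Finset.filter_congr fun i _ => ?_
      exact Set.ext_iff.1 hrange i
    rw [h3] at h1
    rw [h1, card_range, ← ncard_inter_Iio] at h2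
    exact eq_sub_of_add_eq' (by exact_mod_cast h2)
  set r : ℕ → ℝ := fun n =>
    (({j | j ∈ J ∧ (j = 0 ∨ j - 1 ∉ J)} ∩ Set.Iio n).ncard : ℝ) with hr
  have hr0 : Tendsto (fun n : ℕ => r n / n) atTop (𝓝 0) := tendsto_of_upperDensity_eq_zero hblocks
  have hr1 : Tendsto (fun K : ℕ => l * (2 * r (K + l + 1)) / K) atTop (𝓝 0) := by
    have h1 := hr0.comp (tendsto_add_atTop_nat (l + 1))
    have h2 : Tendsto (fun K : ℕ => 1 + ((l : ℝ) + 1) / (K : ℝ)) atTop (𝓝 (1 + 0)) :=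
      (tendsto_const_div_atTop_nhds_zero_nat _).const_add 1
    have h3 := (h1.mul h2).const_mul ((l : ℝ) * 2)
    rw [zero_mul, mul_zero] at h3
    refine h3.congr' ?_
    filter_upwards [eventually_gt_atTop 0] with K hK
    have hK' : (K : ℝ) ≠ 0 := by positivity
    have hK2 : (K : ℝ) + (l + 1) ≠ 0 := by positivity
    simp only [Function.comp_apply, ← add_assoc]
    push_cast
    rw [add_assoc]
    field_simp
    ring
  have hS' : Tendsto (fun K : ℕ => |(occCount S v (m K) / m K : ℝ) - ((b : ℝ) ^ l)⁻¹|) atTop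
      (𝓝 0) := by
    have := (((hS.tendsto_occCount hl v).comp hmtop).sub_const ((b : ℝ) ^ l)⁻¹).abs
    simpa using this
  have hsum := hr1.add hS'
  rw [add_zero] at hsum
  refine squeeze_zero_norm' ?_ hsum
  filter_upwards [eventually_gt_atTop 0, hmtop.eventually_gt_atTop 0] with K hK hmpos
  have hKr : (0 : ℝ) < K := by exact_mod_cast hK
  have hmr : (0 : ℝ) < m K := by exact_mod_cast hmpos
  have h1 := abs_occCount_sub_le hg hrange hmatch hzero hm v K
  set z : ℝ := ((J ∩ Set.Iio K).ncard : ℝ) with hz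
  have hz0 : 0 ≤ z := by positivity
  have hmz : (m K : ℝ) = K - z := hmK K
  have hq : 1 - z / K = m K / K := by rw [hmz]; field_simp
  rw [hq, Real.norm_eq_abs]
  have hsplit : (occCount T v K / K : ℝ) -
      ((m K / K) * ((b : ℝ) ^ l)⁻¹ + z / K * if v = fun _ => a then 1 else 0) =
      ((occCount T v K : ℝ) - (occCount S v (m K) + if v = fun _ => a then z else 0)) / K +
        (m K / K) * ((occCount S v (m K) / m K : ℝ) - ((b : ℝ) ^ l)⁻¹) := by
    split_ifs <;> field_simp <;> ring
  rw [hsplit]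
  refine (abs_add_le _ _).trans (add_le_add ?_ ?_)
  · rw [abs_div, abs_of_pos hKr]
    exact div_le_div_of_nonneg_right h1 hKr.le
  · rw [abs_mul, abs_of_nonneg (by positivity : (0 : ℝ) ≤ m K / K)]
    refine mul_le_of_le_one_left (abs_nonneg _) ?_
    rw [div_le_one hKr]
    linarith

theorem tendsto_negMulLog_sub_s8 {ι : Type*} {f : Filter ι} {x y : ι → ℝ}
    (hx : ∀ i, x i ∈ Set.Icc (0 : ℝ) 1) (hy : ∀ i, y i ∈ Set.Icc (0 : ℝ) 1)
    (h : Tendsto (fun i => x i - y i) f (𝓝 0)) :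
    Tendsto (fun i => Real.negMulLog (x i) - Real.negMulLog (y i)) f (𝓝 0) := by
  have huc := (isCompact_Icc (a := (0 : ℝ)) (b := 1)).uniformContinuousOn_of_continuous
    Real.continuous_negMulLog.continuousOn
  rw [Metric.uniformContinuousOn_iff] at huc
  rw [Metric.tendsto_nhds] at h ⊢
  intro ε hε
  obtain ⟨δ, hδ, H⟩ := huc ε hε
  filter_upwards [h δ hδ] with i hi
  rw [Real.dist_0_eq_abs] at hi ⊢
  exact H _ (hx i) _ (hy i) hi

theorem negMulLog_le_one {x : ℝ} (hx : 0 ≤ x) : Real.negMulLog x ≤ 1 := by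
  rcases hx.eq_or_lt with rfl | hx
  · simp
  · have h := mul_le_mul_of_nonneg_left (Real.one_sub_inv_le_log_of_pos hx) hx.le
    rw [mul_sub, mul_one, mul_inv_cancel₀ hx.ne'] at h
    rw [Real.negMulLog]
    linarith

theorem negMulLog_inv_pow (b l : ℕ) :
    Real.negMulLog ((b : ℝ) ^ l)⁻¹ = ((b : ℝ) ^ l)⁻¹ * (l * Real.log b) := by
  rw [Real.negMulLog, Real.log_inv, Real.log_pow]
  ring

theorem le_sum_negMulLog_mixture {b l : ℕ} (hb : b ≠ 0) (w : Fin l → Fin b) {q : ℝ}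
    (hq : q ∈ Set.Icc (0 : ℝ) 1) :
    q * (l * Real.log b) ≤ ∑ v : Fin l → Fin b,
      Real.negMulLog (q * ((b : ℝ) ^ l)⁻¹ + (1 - q) * if v = w then 1 else 0) := by
  have hcard : (Fintype.card (Fin l → Fin b) : ℝ) = (b : ℝ) ^ l := by simp
  have hb0 : (b : ℝ) ^ l ≠ 0 := by positivity
  calc q * (l * Real.log b)
      = ∑ _v : Fin l → Fin b, q * Real.negMulLog ((b : ℝ) ^ l)⁻¹ := by
        rw [sum_const, card_univ, nsmul_eq_mul, hcard, negMulLog_inv_pow]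
        field_simp
    _ ≤ _ := by
        refine sum_le_sum fun v _ => ?_
        have h := Real.concaveOn_negMulLog.2 (x := ((b : ℝ) ^ l)⁻¹)
          (y := if v = w then 1 else 0) (Set.mem_Ici.2 (by positivity))
          (Set.mem_Ici.2 (by split_ifs <;> norm_num)) hq.1 (sub_nonneg.2 hq.2) (by ring)
        have h0 : Real.negMulLog (if v = w then 1 else 0) = 0 := by split_ifs <;> simp
        simpa [h0] using h

theorem sum_negMulLog_mixture_le {b l : ℕ} (hb : b ≠ 0) (w : Fin l → Fin b) {q : ℝ}
    (hq : q ∈ Set.Icc (0 : ℝ) 1) :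
    ∑ v : Fin l → Fin b,
      Real.negMulLog (q * ((b : ℝ) ^ l)⁻¹ + (1 - q) * if v = w then 1 else 0) ≤
        q * (l * Real.log b) + 2 := by
  have hcard : (Fintype.card (Fin l → Fin b) : ℝ) = (b : ℝ) ^ l := by simp
  have hb0 : (b : ℝ) ^ l ≠ 0 := by positivity
  have hlog : 0 ≤ Real.log b := Real.log_natCast_nonneg b
  calc _ ≤ ∑ v : Fin l → Fin b, ((((b : ℝ) ^ l)⁻¹ + q * (((b : ℝ) ^ l)⁻¹ * (l * Real.log b))) +
        if v = w then 1 else 0) := by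
        refine sum_le_sum fun v _ => ?_
        have hq0 := hq.1
        have hq1 := sub_nonneg.2 hq.2
        split_ifs
        · refine (negMulLog_le_one (by positivity)).trans ?_
          have : 0 ≤ ((b : ℝ) ^ l)⁻¹ + q * (((b : ℝ) ^ l)⁻¹ * (l * Real.log b)) := by positivity
          linarith
        · rw [mul_zero, add_zero, add_zero, Real.negMulLog_mul, negMulLog_inv_pow]
          have := mul_le_of_le_one_right (by positivity : 0 ≤ ((b : ℝ) ^ l)⁻¹)
            (negMulLog_le_one hq0)
          linarith
    _ = _ := by
        rw [sum_add_distrib, sum_const, card_univ, nsmul_eq_mul, hcard]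
        simp only [sum_ite_eq', mem_univ, if_true]
        field_simp
        ring

/-- The block entropies of the diluted sequence are close to the density of the original symbols,
up to an error vanishing as the block length grows. -/
theorem eventually_occEntropy_mem {b : ℕ} (hb : 2 ≤ b) {S T : ℕ → Fin b} {J : Set ℕ} {a : Fin b}
    (hS : BorelNormal S) {g : ℕ → ℕ} (hg : StrictMono g) (hrange : Set.range g = Jᶜ)
    (hmatch : ∀ n, T (g n) = S n) (hzero : ∀ j ∈ J, T j = a)
    (hblocks : upperDensity {j | j ∈ J ∧ (j = 0 ∨ j - 1 ∉ J)} = 0) {l : ℕ} (hl : l ≠ 0)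
    {δ : ℝ} (hδ : 0 < δ) :
    ∀ᶠ K : ℕ in atTop, occEntropy T l K ∈
      Set.Icc (1 - ((J ∩ Set.Iio K).ncard : ℝ) / K - δ)
        (1 - ((J ∩ Set.Iio K).ncard : ℝ) / K + 2 / (l * Real.log b) + δ) := by
  have hb0 : b ≠ 0 := by omega
  have hc : 0 < l * Real.log b :=
    mul_pos (by positivity) (Real.log_pos (by exact_mod_cast hb))
  have hbl : ((b : ℝ) ^ l)⁻¹ ∈ Set.Icc (0 : ℝ) 1 :=
    ⟨by positivity, inv_le_one_of_one_le₀ (one_le_pow₀ (by exact_mod_cast Nat.one_le_of_lt hb))⟩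
  set z : ℕ → ℝ := fun K => ((J ∩ Set.Iio K).ncard : ℝ) / K with hz
  have hzmem : ∀ K, z K ∈ Set.Icc (0 : ℝ) 1 := fun K => ncard_inter_Iio_div_mem_Icc J K
  have hqmem : ∀ K, 1 - z K ∈ Set.Icc (0 : ℝ) 1 := fun K =>
    ⟨sub_nonneg.2 (hzmem K).2, sub_le_self _ (hzmem K).1⟩
  set y : (Fin l → Fin b) → ℕ → ℝ := fun v K =>
    (1 - z K) * ((b : ℝ) ^ l)⁻¹ + (1 - (1 - z K)) * if v = fun _ => a then 1 else 0 with hy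
  have hlim : Tendsto (fun K : ℕ => ∑ v : Fin l → Fin b,
      (Real.negMulLog (occCount T v K / K) - Real.negMulLog (y v K))) atTop (𝓝 0) := by
    rw [← sum_const_zero (s := (univ : Finset (Fin l → Fin b)))]
    refine tendsto_finsetSum _ fun v _ => tendsto_negMulLog_sub_s8 (fun K => ?_) (fun K => ?_) ?_
    · exact ⟨by positivity,
        div_le_one_of_le₀ (by exact_mod_cast occCount_le T v K) (by positivity)⟩
    · have hind : (if v = fun _ => a then (1 : ℝ) else 0) ∈ Set.Icc (0 : ℝ) 1 := by
        split_ifs <;> simp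
      exact convex_Icc (0 : ℝ) 1 hbl hind (hqmem K).1 (by linarith [(hzmem K).1]) (by ring)
    · have := tendsto_occCount_sub hS hg hrange hmatch hzero hblocks hl v
      simpa only [hy, sub_sub_cancel] using this
  have hev := (Metric.tendsto_nhds.1 hlim) (δ * (l * Real.log b)) (by positivity)
  filter_upwards [hev] with K hK
  rw [Real.dist_0_eq_abs, sum_sub_distrib, abs_lt] at hK
  have hlo := le_sum_negMulLog_mixture hb0 (fun _ : Fin l => a) (hqmem K)
  have hhi := sum_negMulLog_mixture_le hb0 (fun _ : Fin l => a) (hqmem K)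
  unfold occEntropy
  rw [Fintype.card_fin, Set.mem_Icc, le_div_iff₀ hc, div_le_iff₀ hc]
  have h2 : (1 - z K + 2 / (l * Real.log b) + δ) * (l * Real.log b) =
      (1 - z K) * (l * Real.log b) + 2 + δ * (l * Real.log b) := by
    rw [add_mul, add_mul, div_mul_cancel₀ _ hc.ne']
  constructor
  · linarith [hK.1]
  · rw [h2]
    linarith [hK.2]

theorem liminf_limsup_bounds {u q : ℕ → ℝ} (hq : ∀ n, q n ∈ Set.Icc (0 : ℝ) 1) {ε : ℝ}
    (h : ∀ δ > 0, ∀ᶠ n in atTop, u n ∈ Set.Icc (q n - δ) (q n + ε + δ)) :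
    liminf u atTop ∈ Set.Icc (liminf q atTop) (liminf q atTop + ε) ∧
      limsup u atTop ∈ Set.Icc (limsup q atTop) (limsup q atTop + ε) := by
  have hqa : IsBoundedUnder (· ≤ ·) atTop q := isBoundedUnder_of ⟨1, fun n => (hq n).2⟩
  have hqb : IsBoundedUnder (· ≥ ·) atTop q := isBoundedUnder_of ⟨0, fun n => (hq n).1⟩
  have hua : IsBoundedUnder (· ≤ ·) atTop u := by
    refine ⟨1 + ε + 1, eventually_map.2 ?_⟩
    filter_upwards [h 1 one_pos] with n hn
    linarith [hn.2, (hq n).2]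
  have hub : IsBoundedUnder (· ≥ ·) atTop u := by
    refine ⟨-1, eventually_map.2 ?_⟩
    filter_upwards [h 1 one_pos] with n hn
    linarith [hn.1, (hq n).1]
  have hadda : ∀ c : ℝ, IsBoundedUnder (· ≤ ·) atTop fun n => q n + c := fun c =>
    isBoundedUnder_of ⟨1 + c, fun n => by linarith [(hq n).2]⟩
  have haddb : ∀ c : ℝ, IsBoundedUnder (· ≥ ·) atTop fun n => q n + c := fun c =>
    isBoundedUnder_of ⟨c, fun n => by linarith [(hq n).1]⟩
  have hinf : ∀ c : ℝ, liminf (fun n => q n + c) atTop = liminf q atTop + c := fun c =>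
    liminf_add_const atTop q c hqa.isCoboundedUnder_ge hqb
  have hsup : ∀ c : ℝ, limsup (fun n => q n + c) atTop = limsup q atTop + c := fun c =>
    limsup_add_const atTop q c hqa hqb.isCoboundedUnder_le
  have hlo : ∀ δ > 0, ∀ᶠ n in atTop, q n + -δ ≤ u n := fun δ hδ =>
    (h δ hδ).mono fun n hn => by linarith [hn.1]
  have hhi : ∀ δ > 0, ∀ᶠ n in atTop, u n ≤ q n + (ε + δ) := fun δ hδ =>
    (h δ hδ).mono fun n hn => by linarith [hn.2]
  refine ⟨⟨?_, ?_⟩, ⟨?_, ?_⟩⟩ <;> refine le_of_forall_pos_le_add fun δ hδ => ?_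
  · have := liminf_le_liminf (hlo δ hδ) (haddb _) hua.isCoboundedUnder_ge
    rw [hinf] at this
    linarith
  · have := liminf_le_liminf (hhi δ hδ) hub (hadda _).isCoboundedUnder_ge
    rw [hinf] at this
    linarith
  · have := limsup_le_limsup (hlo δ hδ) (haddb _).isCoboundedUnder_le hua
    rw [hsup] at this
    linarith
  · have := limsup_le_limsup (hhi δ hδ) hub.isCoboundedUnder_le (hadda _)
    rw [hsup] at this
    linarith

theorem ciInf_eq_of_mem_Icc_of_tendsto {x ε : ℕ → ℝ} {c : ℝ} (hε : Tendsto ε atTop (𝓝 0))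
    (h : ∀ l, x l ∈ Set.Icc c (c + ε l)) : ⨅ l, x l = c := by
  have hbdd : BddBelow (Set.range x) := ⟨c, by rintro _ ⟨l, rfl⟩; exact (h l).1⟩
  refine le_antisymm ?_ (le_ciInf fun l => (h l).1)
  refine ge_of_tendsto' (f := fun l => c + ε l) (x := atTop) (by simpa using hε.const_add c)
    fun l => (ciInf_le hbdd l).trans (h l).2

/-- Let `S` be Borel normal in base `b ≥ 2` and let `T = S⁰` be
obtained from `S` by inserting strings of zeros at the set of positions `J`
(witnessed by the strictly monotone enumeration `g` of the non-inserted positions),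
such that the set of inserted strings (identified with the set of starting positions
of the maximal inserted zero-blocks) has upper asymptotic density zero. With
`z(n) = |J ∩ [0,n)|` the number of inserted zeros in the length-`n` prefix of `S⁰`,
`dim_FS(S⁰) = 1 − limsup_n z(n)/n` and `Dim_FS(S⁰) = 1 − liminf_n z(n)/n`. -/
theorem stmt8 (b : ℕ) (hb : 2 ≤ b) (S T : ℕ → Fin b) (J : Set ℕ)
    (hS : BorelNormal S)
    (g : ℕ → ℕ) (hg : StrictMono g) (hrange : Set.range g = Jᶜ)
    (hmatch : ∀ n : ℕ, T (g n) = S n)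
    (hzero : ∀ j ∈ J, T j = (⟨0, by omega⟩ : Fin b))
    (hblocks : upperDensity {j | j ∈ J ∧ (j = 0 ∨ j - 1 ∉ J)} = 0) :
    dimFS T = 1 - Filter.limsup (fun n => ((J ∩ Set.Iio n).ncard : ℝ) / n) Filter.atTop ∧
    DimFS T = 1 - Filter.liminf (fun n => ((J ∩ Set.Iio n).ncard : ℝ) / n) Filter.atTop := by
  have hb1 : 0 < Real.log b := Real.log_pos (by exact_mod_cast hb)
  set z : ℕ → ℝ := fun n => ((J ∩ Set.Iio n).ncard : ℝ) / n with hz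
  have hzmem : ∀ n, z n ∈ Set.Icc (0 : ℝ) 1 := fun n => ncard_inter_Iio_div_mem_Icc J n
  have hza : IsBoundedUnder (· ≤ ·) atTop z := isBoundedUnder_of ⟨1, fun n => (hzmem n).2⟩
  have hzb : IsBoundedUnder (· ≥ ·) atTop z := isBoundedUnder_of ⟨0, fun n => (hzmem n).1⟩
  have hqmem : ∀ n, 1 - z n ∈ Set.Icc (0 : ℝ) 1 := fun n =>
    ⟨sub_nonneg.2 (hzmem n).2, sub_le_self _ (hzmem n).1⟩
  have hbounds := fun l : ℕ => liminf_limsup_bounds hqmem fun δ hδ =>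
    eventually_occEntropy_mem hb hS hg hrange hmatch hzero hblocks (Nat.succ_ne_zero l) hδ
  have hε : Tendsto (fun l : ℕ => 2 / (((l + 1 : ℕ) : ℝ) * Real.log b)) atTop (𝓝 0) := by
    have h := (tendsto_const_div_atTop_nhds_zero_nat (2 / Real.log b)).comp
      (tendsto_add_atTop_nat 1)
    refine h.congr fun l => ?_
    simp only [Function.comp_apply]
    rw [div_div, mul_comm]
  constructor
  · rw [← liminf_const_sub atTop z 1 hza hzb.isCoboundedUnder_le]
    unfold dimFS
    simp only [liminf_slideH]
    exact ciInf_eq_of_mem_Icc_of_tendsto hε fun l => (hbounds l).1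
  · rw [← limsup_const_sub atTop z 1 hza.isCoboundedUnder_ge hzb]
    unfold DimFS
    simp only [limsup_slideH]
    exact ciInf_eq_of_mem_Icc_of_tendsto hε fun l => (hbounds l).2
end
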